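/- Suppose M is a von Neumann algebra on a complex Hilbert space H, A, B ∈ M, and (B_n) is a sequence in M such that M-rank(B_n) ≤ M-rank(A) for every n (i.e., for each n there is a partial isometry v_n ∈ M with v_n* v_n = R(B_n) and v_n v_n* ≤ R(A)). If B_n → B in the strong-* operator topology (B_n x → B x and B_n* x → B* x for every x ∈ H), then M-rank(B) ≤ M-rank(A), i.e., there is a partial isometry w ∈ M with w* w = R(B) and w w* ≤ R(A). -/

import Mathlib

open Filter

variable {H : Type*} [NormedAddCommGroup H] [InnerProductSpace ℂ H] [CompleteSpace H]

/-- `r` is the orthogonal projection onto the closure of the range of `T`. -/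
def IsRangeProjection (r T : H →L[ℂ] H) : Prop :=
  r * r = r ∧ IsSelfAdjoint r ∧ Set.range r = closure (Set.range T)

set_option linter.unusedSectionVars false

local notation "⟪" x "," y "⟫" => inner ℂ x y

namespace VonNeumannAlgebra

variable {M : VonNeumannAlgebra H}

lemma mem_of_forall_commutant {T : H →L[ℂ] H}
    (h : ∀ c ∈ M.commutant, ∀ x, c (T x) = T (c x)) : T ∈ M := by
  rw [← M.commutant_commutant, mem_commutant_iff]
  intro c hc
  ext x
  exact h c hc x

lemma apply_comm {T c : H →L[ℂ] H} (hT : T ∈ M) (hc : c ∈ M.commutant) (x : H) :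
    c (T x) = T (c x) :=
  (DFunLike.congr_fun (mem_commutant_iff.1 hc T hT) x).symm

lemma star_inner_left (T : H →L[ℂ] H) (x y : H) : ⟪star T x, y⟫ = ⟪x, T y⟫ :=
  ContinuousLinearMap.adjoint_inner_left T y x

lemma star_inner_right (T : H →L[ℂ] H) (x y : H) : ⟪x, star T y⟫ = ⟪T x, y⟫ :=
  ContinuousLinearMap.adjoint_inner_right T x y

/-- The closed subspaces of `H` that are the ranges of the projections of `M`. -/
structure IsAffiliated (M : VonNeumannAlgebra H) (W : Submodule ℂ H) : Prop where
  closed : IsClosed (W : Set H)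
  inv : ∀ c ∈ M.commutant, ∀ x ∈ W, c x ∈ W

lemma IsAffiliated.exists_proj {W : Submodule ℂ H} (hW : IsAffiliated M W) :
    ∃ p ∈ M, star p = p ∧ (∀ x, p x ∈ W) ∧ (∀ x ∈ W, p x = x) ∧
      (∀ x, ∀ w ∈ W, ⟪w, x - p x⟫ = 0) ∧ ∀ x, (∀ w ∈ W, ⟪w, x⟫ = 0) → p x = 0 := by
  have : CompleteSpace W := hW.closed.completeSpace_coe
  have hsa : star W.starProjection = W.starProjection :=
    (isStarProjection_starProjection (U := W)).isSelfAdjoint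
  refine ⟨W.starProjection, ?_, hsa, W.starProjection_apply_mem,
    fun x hx => Submodule.starProjection_eq_self_iff.2 hx, fun x w hw => ?_, fun x hx => ?_⟩
  · rw [IsStarProjection.mem_iff isStarProjection_starProjection]
    intro c hc
    rw [Submodule.range_starProjection]
    exact hW.inv c hc
  · exact W.sub_starProjection_mem_orthogonal x w hw
  · exact W.starProjection_apply_eq_zero_iff.2 hx

/-- The closed linear span of a set. -/
noncomputable def cspan (S : Set H) : Submodule ℂ H := (Submodule.span ℂ S).topologicalClosure

lemma isClosed_cspan (S : Set H) : IsClosed (cspan S : Set H) :=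
  Submodule.isClosed_topologicalClosure _

lemma subset_cspan {S : Set H} {x : H} (hx : x ∈ S) : x ∈ cspan S :=
  Submodule.le_topologicalClosure _ (Submodule.subset_span hx)

lemma cspan_le {S : Set H} {W : Submodule ℂ H} (hW : IsClosed (W : Set H)) (h : ∀ x ∈ S, x ∈ W) :
    cspan S ≤ W :=
  Submodule.topologicalClosure_minimal _ (Submodule.span_le.2 h) hW

lemma inner_eq_zero_of_mem_cspan {S : Set H} {x y : H} (h : ∀ s ∈ S, ⟪s, x⟫ = 0)
    (hy : y ∈ cspan S) : ⟪y, x⟫ = 0 := by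
  have : cspan S ≤ (ℂ ∙ x)ᗮ := cspan_le (Submodule.isClosed_orthogonal _) fun s hs =>
    Submodule.mem_orthogonal_singleton_iff_inner_left.2 (h s hs)
  exact Submodule.mem_orthogonal_singleton_iff_inner_left.1 (this hy)

lemma map_mem_of_mem_cspan {S : Set H} {W : Submodule ℂ H} (hW : IsClosed (W : Set H))
    (T : H →L[ℂ] H) (h : ∀ s ∈ S, T s ∈ W) {x : H} (hx : x ∈ cspan S) : T x ∈ W :=
  cspan_le (W := W.comap (T : H →ₗ[ℂ] H)) (hW.preimage T.continuous) h hx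

lemma isAffiliated_cspan {S : Set H} (h : ∀ c ∈ M.commutant, ∀ x ∈ S, c x ∈ S) :
    IsAffiliated M (cspan S) :=
  ⟨isClosed_cspan S, fun c hc _ hx => map_mem_of_mem_cspan (isClosed_cspan S) c
    (fun s hs => subset_cspan (h c hc s hs)) hx⟩

/-- A set of pairs that is invariant under the commutant and preserves inner products is
contained in the graph of a partial isometry of `M`. -/
theorem exists_partialIsometry (X : Set (H × H))
    (hc : ∀ c ∈ M.commutant, ∀ p ∈ X, (c p.1, c p.2) ∈ X)
    (hX : ∀ p ∈ X, ∀ q ∈ X, ⟪p.1, q.1⟫ = ⟪p.2, q.2⟫) :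
    ∃ v ∈ M, (∀ p ∈ X, v p.1 = p.2) ∧ (∀ x ∈ cspan (Prod.fst '' X), ‖v x‖ = ‖x‖) ∧
      (∀ x, v x ∈ cspan (Prod.snd '' X)) ∧
      (∀ x, (∀ p ∈ X, ⟪p.1, x⟫ = 0) → v x = 0) := by
  set P : Submodule ℂ (H × H) := (Submodule.span ℂ X).topologicalClosure with hP
  have hPcl : IsClosed (P : Set (H × H)) := Submodule.isClosed_topologicalClosure _
  have hXP : ∀ p ∈ X, p ∈ P := fun p hp =>
    Submodule.le_topologicalClosure _ (Submodule.subset_span hp)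
  have key : ∀ (φ : (H × H) →L[ℂ] ℂ), (∀ p ∈ X, φ p = 0) → ∀ p ∈ P, φ p = 0 := by
    intro φ h p hp
    have : P ≤ LinearMap.ker (φ : (H × H) →ₗ[ℂ] ℂ) :=
      Submodule.topologicalClosure_minimal _ (Submodule.span_le.2 h) φ.isClosed_ker
    exact this hp
  have h1 : ∀ p ∈ X, ∀ q ∈ P, ⟪p.1, q.1⟫ = ⟪p.2, q.2⟫ := by
    intro p hp q hq
    have := key ((innerSL ℂ p.1).comp (.fst ℂ H H) - (innerSL ℂ p.2).comp (.snd ℂ H H))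
      (fun q hq => by simp [hX p hp q hq]) q hq
    simpa [sub_eq_zero] using this
  have h2 : ∀ p ∈ P, ∀ q ∈ P, ⟪p.1, q.1⟫ = ⟪p.2, q.2⟫ := by
    intro p hp q hq
    have := key ((innerSL ℂ q.1).comp (.fst ℂ H H) - (innerSL ℂ q.2).comp (.snd ℂ H H))
      (fun r hr => by
        have := h1 r hr q hq
        simp only [FunLike.coe_sub, Pi.sub_apply, sub_eq_zero,
          ContinuousLinearMap.comp_apply, innerSL_apply_apply, ContinuousLinearMap.coe_fst',
          ContinuousLinearMap.coe_snd']
        rw [← inner_conj_symm q.1, ← inner_conj_symm q.2, this]) p hp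
    simp only [FunLike.coe_sub, Pi.sub_apply, sub_eq_zero,
          ContinuousLinearMap.comp_apply, innerSL_apply_apply, ContinuousLinearMap.coe_fst',
          ContinuousLinearMap.coe_snd'] at this
    rw [← inner_conj_symm p.1, ← inner_conj_symm p.2, this]
  have hnorm : ∀ p ∈ P, ‖p.1‖ = ‖p.2‖ := by
    intro p hp
    have := h2 p hp p hp
    rw [inner_self_eq_norm_sq_to_K, inner_self_eq_norm_sq_to_K] at this
    have h3 : ‖p.1‖ ^ 2 = ‖p.2‖ ^ 2 := by exact_mod_cast this
    exact (sq_eq_sq₀ (norm_nonneg _) (norm_nonneg _)).1 h3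
  have : CompleteSpace P := hPcl.completeSpace_coe
  let f : P →ₗᵢ[ℂ] H :=
    ⟨(LinearMap.fst ℂ H H).comp P.subtype, fun p => by
      have := hnorm p p.2
      change ‖(p : H × H).1‖ = ‖(p : H × H)‖
      rw [Prod.norm_def, ← this, max_self]⟩
  let U : Submodule ℂ H := LinearMap.range f.toLinearMap
  have hUcl : IsClosed (U : Set H) := by
    have := f.isometry.isClosedEmbedding.isClosed_range
    simpa [U, LinearMap.coe_range] using this
  have hcP : ∀ c ∈ M.commutant, ∀ p ∈ P, (c p.1, c p.2) ∈ P := by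
    intro c hc' p hp
    have : P ≤ P.comap ((c.prodMap c : (H × H) →L[ℂ] (H × H)) : (H × H) →ₗ[ℂ] (H × H)) :=
      Submodule.topologicalClosure_minimal _ (Submodule.span_le.2 fun q hq =>
        hXP _ (hc c hc' q hq)) (hPcl.preimage (c.prodMap c).continuous)
    exact this hp
  have hU : IsAffiliated M U := ⟨hUcl, by
    rintro c hc' _ ⟨p, rfl⟩
    exact ⟨⟨_, hcP c hc' p p.2⟩, rfl⟩⟩
  obtain ⟨p, hpM, -, hpU, hpfix, -, hp0⟩ := hU.exists_proj
  let e := f.equivRange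
  let g : U →L[ℂ] H := ((ContinuousLinearMap.snd ℂ H H).comp P.subtypeL).comp
    (e.symm.toContinuousLinearEquiv : U →L[ℂ] P)
  let v : H →L[ℂ] H := g.comp (p.codRestrict U hpU)
  have hv : ∀ q ∈ P, v q.1 = q.2 := by
    intro q hq
    have hqU : q.1 ∈ U := ⟨⟨q, hq⟩, rfl⟩
    have : p.codRestrict U hpU q.1 = e ⟨q, hq⟩ := by
      apply Subtype.ext
      exact hpfix _ hqU
    change ((e.symm (p.codRestrict U hpU q.1) : P) : H × H).2 = q.2
    rw [this, e.symm_apply_apply]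
  have hv0 : ∀ x, v x = v (p x) := by
    intro x
    have : p.codRestrict U hpU x = p.codRestrict U hpU (p x) :=
      Subtype.ext (hpfix _ (hpU x)).symm
    exact congrArg g this
  have hUgen : U = cspan (Prod.fst '' X) := by
    apply le_antisymm
    · rintro _ ⟨q, rfl⟩
      have : P ≤ (cspan (Prod.fst '' X)).comap (LinearMap.fst ℂ H H) :=
        Submodule.topologicalClosure_minimal _ (Submodule.span_le.2 fun r hr =>
          subset_cspan ⟨r, hr, rfl⟩) ((isClosed_cspan _).preimage continuous_fst)
      exact this q.2
    · refine cspan_le hUcl ?_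
      rintro _ ⟨r, hr, rfl⟩
      exact ⟨⟨r, hXP r hr⟩, rfl⟩
  refine ⟨v, ?_, fun q hq => hv q (hXP q hq), ?_, ?_, ?_⟩
  · refine mem_of_forall_commutant fun c hc' x => ?_
    rw [hv0 x, hv0 (c x), ← apply_comm hpM hc']
    obtain ⟨q, hq⟩ := hpU x
    change (q : H × H).1 = p x at hq
    rw [← hq, hv q q.2]
    exact (hv _ (hcP c hc' q q.2)).symm
  · rw [← hUgen]
    rintro _ ⟨q, rfl⟩
    change ‖v (q : H × H).1‖ = ‖(q : H × H).1‖
    rw [hv q q.2, hnorm q q.2]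
  · intro x
    rw [hv0]
    obtain ⟨q, hq⟩ := hpU x
    change (q : H × H).1 = p x at hq
    rw [← hq, hv q q.2]
    have : P ≤ (cspan (Prod.snd '' X)).comap (LinearMap.snd ℂ H H) :=
        Submodule.topologicalClosure_minimal _ (Submodule.span_le.2 fun r hr =>
          subset_cspan ⟨r, hr, rfl⟩) ((isClosed_cspan _).preimage continuous_snd)
    exact this q.2
  · intro x hx
    rw [hv0, hp0, map_zero]
    intro w hw
    rw [hUgen] at hw
    refine inner_eq_zero_of_mem_cspan ?_ hw
    rintro _ ⟨q, hq, rfl⟩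
    exact hx q hq

/-- `W` is carried isometrically into `V` by an element of `M`. -/
def Emb (M : VonNeumannAlgebra H) (W V : Submodule ℂ H) : Prop :=
  ∃ v ∈ M, ∀ x ∈ W, ‖v x‖ = ‖x‖ ∧ v x ∈ V

lemma Emb.trans {U V W : Submodule ℂ H} (h₁ : Emb M U V) (h₂ : Emb M V W) : Emb M U W := by
  obtain ⟨v, hv, hv'⟩ := h₁
  obtain ⟨w, hw, hw'⟩ := h₂
  refine ⟨w * v, mul_mem hw hv, fun x hx => ?_⟩
  have h1 := hv' x hx
  have h2 := hw' _ h1.2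
  exact ⟨h2.1.trans h1.1, h2.2⟩

lemma Emb.mono {U U' V V' : Submodule ℂ H} (h : Emb M U V) (hU : U' ≤ U) (hV : V ≤ V') :
    Emb M U' V' := by
  obtain ⟨v, hv, hv'⟩ := h
  exact ⟨v, hv, fun x hx => ⟨(hv' x (hU hx)).1, hV (hv' x (hU hx)).2⟩⟩

lemma Emb.of_le {U V : Submodule ℂ H} (h : U ≤ V) : Emb M U V :=
  ⟨1, one_mem M, fun _ hx => ⟨rfl, h hx⟩⟩

/-- `v` is the partial isometry of `M` with initial space `W`, and its range lies in `V`. -/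
structure IsPartialIsom (M : VonNeumannAlgebra H) (v : H →L[ℂ] H) (W V : Submodule ℂ H) :
    Prop where
  mem : v ∈ M
  map_mem : ∀ x, v x ∈ V
  star_map : ∀ x ∈ W, star v (v x) = x
  star_mem : ∀ x, star v x ∈ W
  map_eq_zero : ∀ x, (∀ w ∈ W, ⟪w, x⟫ = 0) → v x = 0

lemma IsPartialIsom.inner_map {v : H →L[ℂ] H} {W V : Submodule ℂ H} (h : IsPartialIsom M v W V)
    {x : H} (hx : x ∈ W) (y : H) : ⟪v x, v y⟫ = ⟪x, y⟫ := by
  rw [← star_inner_left, h.star_map x hx]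

lemma IsPartialIsom.norm_map {v : H →L[ℂ] H} {W V : Submodule ℂ H} (h : IsPartialIsom M v W V)
    {x : H} (hx : x ∈ W) : ‖v x‖ = ‖x‖ := by
  rw [@norm_eq_sqrt_re_inner ℂ, @norm_eq_sqrt_re_inner ℂ _ _ _ _ x, h.inner_map hx]

lemma IsPartialIsom.star_eq_zero {v : H →L[ℂ] H} {W V : Submodule ℂ H}
    (h : IsPartialIsom M v W V) {y : H} (hy : ∀ x ∈ W, ⟪v x, y⟫ = 0) : star v y = 0 := by
  have := hy _ (h.star_mem y)
  rwa [← star_inner_right, inner_self_eq_zero] at this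

lemma IsPartialIsom.map_star_map {v : H →L[ℂ] H} {W V : Submodule ℂ H}
    (h : IsPartialIsom M v W V) (x : H) : star v (v (star v x)) = star v x :=
  h.star_map _ (h.star_mem x)

lemma exists_isPartialIsom {v : H →L[ℂ] H} {W V : Submodule ℂ H} (hW : IsAffiliated M W)
    (hv : v ∈ M) (h : ∀ x ∈ W, ‖v x‖ = ‖x‖ ∧ v x ∈ V) :
    ∃ w, IsPartialIsom M w W V ∧ ∀ x ∈ W, w x = v x := by
  obtain ⟨p, hpM, hps, hpW, hpf, hpo, hp0⟩ := hW.exists_proj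
  let f : W →ₗᵢ[ℂ] H := ⟨(v : H →ₗ[ℂ] H).comp W.subtype, fun x => (h x x.2).1⟩
  have hin : ∀ x ∈ W, ∀ y ∈ W, ⟪v x, v y⟫ = ⟪x, y⟫ := fun x hx y hy =>
    f.inner_map_map ⟨x, hx⟩ ⟨y, hy⟩
  refine ⟨v * p, ⟨mul_mem hv hpM, fun x => (h _ (hpW x)).2, fun x hx => ?_, fun x => ?_,
    fun x hx => ?_⟩, fun x hx => ?_⟩
  · refine ext_inner_left ℂ fun y => ?_
    rw [star_inner_right]
    change ⟪v (p y), v (p x)⟫ = _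
    rw [hin _ (hpW y) _ (hpW x), hpf x hx, ← star_inner_right, hps, hpf x hx]
  · rw [star_mul, hps]
    exact hpW _
  · change v (p x) = 0
    rw [hp0 x hx, map_zero]
  · change v (p x) = v x
    rw [hpf x hx]

lemma Emb.exists_isPartialIsom {W V : Submodule ℂ H} (hW : IsAffiliated M W) (h : Emb M W V) :
    ∃ v, IsPartialIsom M v W V := by
  obtain ⟨v, hv, h⟩ := h
  obtain ⟨w, hw, -⟩ := VonNeumannAlgebra.exists_isPartialIsom hW hv h
  exact ⟨w, hw⟩

lemma exists_abs {T : H →L[ℂ] H} (hT : T ∈ M) :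
    ∃ a ∈ M, star a = a ∧ ∀ x y, ⟪a x, a y⟫ = ⟪T x, T y⟫ := by
  have hsa : star (CFC.abs T) = CFC.abs T := (CFC.abs_nonneg T).isSelfAdjoint
  refine ⟨CFC.abs T, ?_, hsa, fun x y => ?_⟩
  · rw [← M.commutant_commutant, mem_commutant_iff]
    intro c hc
    have h1 : Commute c (star T * T) := (mem_commutant_iff.1 hc _ (mul_mem (star_mem hT) hT)).symm
    have h2 : Commute (CFC.abs T) c := by
      rw [CFC.abs, CFC.sqrt]
      exact (h1.symm).cfcₙ_nnreal _
    exact h2.symm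
  · rw [← star_inner_left, ← star_inner_left T, hsa]
    exact congrArg (fun u => inner ℂ u y) (DFunLike.congr_fun (CFC.abs_mul_abs T) x)

lemma commutant_abs_pair {T a c : H →L[ℂ] H} (hT : T ∈ M) (ha : a ∈ M) (hc : c ∈ M.commutant) :
    ∀ p ∈ Set.range fun h => (a h, T h), (c p.1, c p.2) ∈ Set.range fun h => (a h, T h) := by
  rintro _ ⟨h, rfl⟩
  exact ⟨c h, by simp only [apply_comm hT hc, apply_comm ha hc]⟩

lemma IsAffiliated.inf {W V : Submodule ℂ H} (hW : IsAffiliated M W) (hV : IsAffiliated M V) :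
    IsAffiliated M (W ⊓ V) :=
  ⟨hW.closed.inter hV.closed, fun c hc x hx => ⟨hW.inv c hc x hx.1, hV.inv c hc x hx.2⟩⟩

lemma IsAffiliated.orthogonal {W : Submodule ℂ H} (hW : IsAffiliated M W) :
    IsAffiliated M Wᗮ :=
  ⟨W.isClosed_orthogonal, fun c hc x hx w hw => by
    rw [← star_inner_left]
    exact hx _ (hW.inv _ (star_mem hc) w hw)⟩

lemma isAffiliated_ker {T : H →L[ℂ] H} (hT : T ∈ M) :
    IsAffiliated M (LinearMap.ker (T : H →ₗ[ℂ] H)) :=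
  ⟨T.isClosed_ker, fun c hc x hx => by
    change T (c x) = 0
    have hx : T x = 0 := hx
    rw [← apply_comm hT hc, hx, map_zero]⟩

lemma IsAffiliated.mem_of_orthogonal {W U : Submodule ℂ H} (hU : IsAffiliated M U)
    (hUW : U ≤ W) (h : ∀ r ∈ W, r ∈ Uᗮ → r ∈ U) : W ≤ U := by
  obtain ⟨p, -, -, hpU, hpf, hpo, -⟩ := hU.exists_proj
  intro x hx
  have h1 : x - p x ∈ U := h _ (W.sub_mem hx (hUW (hpU x))) (hpo x)
  simpa using U.add_mem h1 (hpU x)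

theorem emb_of_injOn {W V : Submodule ℂ H} (hW : IsAffiliated M W) (hV : IsClosed (V : Set H))
    {T : H →L[ℂ] H} (hT : T ∈ M) (hTV : ∀ x ∈ W, T x ∈ V) (hinj : ∀ x ∈ W, T x = 0 → x = 0) :
    Emb M W V := by
  obtain ⟨p, hpM, hps, hpW, hpf, hpo, hp0⟩ := hW.exists_proj
  have hTp : T * p ∈ M := mul_mem hT hpM
  obtain ⟨a, haM, has, ha⟩ := exists_abs hTp
  obtain ⟨v, hvM, hvX, hviso, hvV, -⟩ :=
    exists_partialIsometry (M := M) (Set.range fun h => (a h, (T * p) h))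
      (fun c hc => commutant_abs_pair hTp haM hc)
      (by rintro _ ⟨x, rfl⟩ _ ⟨y, rfl⟩; exact ha x y)
  refine ⟨v, hvM, fun x hx => ⟨hviso x ?_, ?_⟩⟩
  · have hzero : ∀ r, T (p r) = 0 → a r = 0 := fun r hr => by
      rw [← inner_self_eq_zero (𝕜 := ℂ), ha]
      change ⟪T (p r), _⟫ = 0
      rw [hr, inner_zero_left]
    have haW : ∀ h, a h ∈ W := by
      intro h
      have : a h - p (a h) = 0 := by
        rw [← inner_self_eq_zero (𝕜 := ℂ)]
        have h1 : a (a h - p (a h)) = 0 := hzero _ (by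
          rw [map_sub, hpf _ (hpW _), sub_self, map_zero])
        have h2 : ⟪a h, a h - p (a h)⟫ = 0 := by
          rw [← star_inner_right, has, h1, inner_zero_right]
        rw [inner_sub_left, h2, hpo _ _ (hpW _), sub_zero]
      rw [sub_eq_zero.1 this]
      exact hpW _
    have hUaff : IsAffiliated M (cspan (Prod.fst '' Set.range fun h => (a h, (T * p) h))) := by
      refine isAffiliated_cspan ?_
      rintro c hc _ ⟨_, ⟨h, rfl⟩, rfl⟩
      exact ⟨_, ⟨c h, rfl⟩, (apply_comm haM hc h).symm⟩
    refine hUaff.mem_of_orthogonal (W := W) (cspan_le hW.closed ?_) (fun r hr hr' => ?_) hx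
    · rintro _ ⟨_, ⟨h, rfl⟩, rfl⟩
      exact haW h
    · have h1 : a r = 0 := by
        rw [← inner_self_eq_zero (𝕜 := ℂ), ← star_inner_left, has]
        exact hr' (a (a r)) (subset_cspan ⟨_, ⟨a r, rfl⟩, rfl⟩)
      have h2 : T (p r) = 0 := by
        rw [← inner_self_eq_zero (𝕜 := ℂ)]
        have := ha r r
        rw [h1, inner_zero_left] at this
        exact this.symm
      rw [hpf r hr] at h2
      rw [hinj r hr h2]
      exact Submodule.zero_mem _
  · refine cspan_le hV ?_ (hvV x)
    rintro _ ⟨_, ⟨h, rfl⟩, rfl⟩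
    exact hTV _ (hpW h)

/-- Projections in the centre of `M`. -/
structure IsCentralProj (M : VonNeumannAlgebra H) (z : H →L[ℂ] H) : Prop where
  mem : z ∈ M
  mem_commutant : z ∈ M.commutant
  apply_apply : ∀ x, z (z x) = z x
  star_eq : star z = z

namespace IsCentralProj

variable {z e : H →L[ℂ] H}

lemma apply_comm (hz : IsCentralProj M z) {T : H →L[ℂ] H} (hT : T ∈ M) (x : H) :
    z (T x) = T (z x) := VonNeumannAlgebra.apply_comm hT hz.mem_commutant x

lemma inner_apply (hz : IsCentralProj M z) (x y : H) : ⟪z x, y⟫ = ⟪x, z y⟫ := by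
  rw [← star_inner_left, hz.star_eq]

lemma compl (hz : IsCentralProj M z) : IsCentralProj M (1 - z) :=
  ⟨sub_mem (one_mem _) hz.mem, sub_mem (one_mem _) hz.mem_commutant,
    fun x => by simp [hz.apply_apply], by rw [star_sub, star_one, hz.star_eq]⟩

lemma mul (hz : IsCentralProj M z) (he : IsCentralProj M e) : IsCentralProj M (z * e) := by
  have hcomm : ∀ x, z (e x) = e (z x) := fun x => hz.apply_comm he.mem x
  refine ⟨mul_mem hz.mem he.mem, mul_mem hz.mem_commutant he.mem_commutant, fun x => ?_, ?_⟩
  · change z (e (z (e x))) = z (e x)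
    rw [← hcomm, he.apply_apply, hz.apply_apply]
  · rw [star_mul, hz.star_eq, he.star_eq]
    ext x
    exact (hcomm x).symm

end IsCentralProj

/-- The part of `W` lying under `z`. -/
noncomputable def cut (z : H →L[ℂ] H) (W : Submodule ℂ H) : Submodule ℂ H :=
  W ⊓ LinearMap.ker ((z - 1 : H →L[ℂ] H) : H →ₗ[ℂ] H)

lemma mem_cut {z : H →L[ℂ] H} {W : Submodule ℂ H} {x : H} : x ∈ cut z W ↔ x ∈ W ∧ z x = x := by
  rw [cut, Submodule.mem_inf]
  refine and_congr_right fun _ => ?_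
  change z x - x = 0 ↔ _
  rw [sub_eq_zero]

lemma cut_le (z : H →L[ℂ] H) (W : Submodule ℂ H) : cut z W ≤ W := inf_le_left

lemma IsCentralProj.apply_mem {z : H →L[ℂ] H} {W : Submodule ℂ H} (hz : IsCentralProj M z)
    (hW : IsAffiliated M W) {x : H} (hx : x ∈ W) : z x ∈ cut z W :=
  mem_cut.2 ⟨hW.inv z hz.mem_commutant x hx, hz.apply_apply x⟩

lemma IsCentralProj.isAffiliated_cut {z : H →L[ℂ] H} {W : Submodule ℂ H}
    (hz : IsCentralProj M z) (hW : IsAffiliated M W) : IsAffiliated M (cut z W) :=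
  hW.inf (isAffiliated_ker (sub_mem hz.mem (one_mem _)))

lemma Emb.cut {z : H →L[ℂ] H} {W V : Submodule ℂ H} (hz : IsCentralProj M z) (h : Emb M W V) :
    Emb M (cut z W) (cut z V) := by
  obtain ⟨v, hv, h⟩ := h
  refine ⟨v, hv, fun x hx => ?_⟩
  rw [mem_cut] at hx ⊢
  exact ⟨(h x hx.1).1, (h x hx.1).2, by rw [hz.apply_comm hv, hx.2]⟩

lemma exists_isCentralProj {Z : Submodule ℂ H} (hZ : IsAffiliated M Z)
    (hZ' : ∀ T ∈ M, ∀ x ∈ Z, T x ∈ Z) :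
    ∃ z, IsCentralProj M z ∧ (∀ x, z x ∈ Z) ∧ (∀ x ∈ Z, z x = x) ∧
      ∀ x, (∀ w ∈ Z, ⟪w, x⟫ = 0) → z x = 0 := by
  obtain ⟨p, hpM, hps, hpW, hpf, hpo, hp0⟩ := hZ.exists_proj
  refine ⟨p, ⟨hpM, ?_, fun x => hpf _ (hpW x), hps⟩, hpW, hpf, hp0⟩
  rw [mem_commutant_iff]
  intro T hT
  ext x
  change T (p x) = p (T x)
  have h1 : p (T (x - p x)) = 0 := hp0 _ fun w hw => by
    rw [← star_inner_left]
    exact hpo x _ (hZ' _ (star_mem hT) w hw)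
  rw [map_sub, map_sub, hpf _ (hZ' T hT _ (hpW x)), sub_eq_zero] at h1
  exact h1.symm

lemma exists_separating {W V : Submodule ℂ H} (hW : IsAffiliated M W)
    (h : ∀ T ∈ M, ∀ x ∈ W, ∀ y ∈ V, ⟪T x, y⟫ = 0) :
    ∃ z, IsCentralProj M z ∧ (∀ x ∈ W, z x = x) ∧ ∀ y ∈ V, z y = 0 := by
  have hS : IsAffiliated M (cspan {y | ∃ T ∈ M, ∃ x ∈ W, T x = y}) := by
    refine isAffiliated_cspan ?_
    rintro c hc _ ⟨T, hT, x, hx, rfl⟩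
    exact ⟨T, hT, c x, hW.inv c hc x hx, (apply_comm hT hc x).symm⟩
  obtain ⟨z, hz, -, hzf, hz0⟩ := exists_isCentralProj hS (by
    intro T hT x hx
    refine map_mem_of_mem_cspan (isClosed_cspan _) T ?_ hx
    rintro _ ⟨T', hT', x, hx, rfl⟩
    exact subset_cspan ⟨T * T', mul_mem hT hT', x, hx, rfl⟩)
  refine ⟨z, hz, fun x hx => hzf _ (subset_cspan ⟨1, one_mem _, x, hx, rfl⟩), fun y hy => ?_⟩
  refine hz0 y fun w hw => inner_eq_zero_of_mem_cspan ?_ hw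
  rintro _ ⟨T, hT, x, hx, rfl⟩
  exact h T hT x hx y hy

/-- The comparison theorem of Murray and von Neumann. -/
theorem comparison {W V : Submodule ℂ H} (hW : IsAffiliated M W) (hV : IsAffiliated M V) :
    ∃ z, IsCentralProj M z ∧ Emb M (cut z V) W ∧ Emb M (cut (1 - z) W) V := by
  obtain ⟨X, hX⟩ := zorn_subset {X : Set (H × H) | (∀ p ∈ X, p.1 ∈ W ∧ p.2 ∈ V) ∧
      (∀ c ∈ M.commutant, ∀ p ∈ X, (c p.1, c p.2) ∈ X) ∧
      ∀ p ∈ X, ∀ q ∈ X, ⟪p.1, q.1⟫ = ⟪p.2, q.2⟫} (by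
    intro C hC hchain
    refine ⟨⋃₀ C, ⟨?_, ?_, ?_⟩, fun s hs => Set.subset_sUnion_of_mem hs⟩
    · rintro p ⟨s, hs, hp⟩
      exact (hC hs).1 p hp
    · rintro c hc p ⟨s, hs, hp⟩
      exact ⟨s, hs, (hC hs).2.1 c hc p hp⟩
    · rintro p ⟨s, hs, hp⟩ q ⟨t, ht, hq⟩
      rcases hchain.total hs ht with h | h
      · exact (hC ht).2.2 p (h hp) q hq
      · exact (hC hs).2.2 p hp q (h hq))
  obtain ⟨hXWV, hXc, hXin⟩ := hX.prop
  have hU₁ : IsAffiliated M (cspan (Prod.fst '' X)) := isAffiliated_cspan (by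
    rintro c hc _ ⟨p, hp, rfl⟩
    exact ⟨_, hXc c hc p hp, rfl⟩)
  have hU₂ : IsAffiliated M (cspan (Prod.snd '' X)) := isAffiliated_cspan (by
    rintro c hc _ ⟨p, hp, rfl⟩
    exact ⟨_, hXc c hc p hp, rfl⟩)
  have hW₂ := hW.inf hU₁.orthogonal
  have hV₂ := hV.inf hU₂.orthogonal
  have hdisj : ∀ T ∈ M, ∀ x ∈ W ⊓ (cspan (Prod.fst '' X))ᗮ,
      ∀ y ∈ V ⊓ (cspan (Prod.snd '' X))ᗮ, ⟪T x, y⟫ = 0 := by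
    obtain ⟨p, hpM, hps, hpW, hpf, hpo, hp0⟩ := hW₂.exists_proj
    obtain ⟨q, hqM, hqs, hqV, hqf, hqo, hq0⟩ := hV₂.exists_proj
    intro T hT x hx y hy
    have hS : q * T * p ∈ M := mul_mem (mul_mem hqM hT) hpM
    obtain ⟨a, haM, has, ha⟩ := exists_abs hS
    have haW : ∀ h, a h ∈ W ⊓ (cspan (Prod.fst '' X))ᗮ := by
      intro h
      have : a h - p (a h) = 0 := by
        rw [← inner_self_eq_zero (𝕜 := ℂ)]
        have h1 : a (a h - p (a h)) = 0 := by
          rw [← inner_self_eq_zero (𝕜 := ℂ), ha]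
          change ⟪q (T (p (a h - p (a h)))), _⟫ = 0
          rw [map_sub, hpf _ (hpW _), sub_self, map_zero, map_zero, inner_zero_left]
        have h2 : ⟪a h, a h - p (a h)⟫ = 0 := by
          rw [← star_inner_right, has, h1, inner_zero_right]
        rw [inner_sub_left, h2, hpo _ _ (hpW _), sub_zero]
      rw [sub_eq_zero.1 this]
      exact hpW _
    have hmem : X ∪ (Set.range fun h => (a h, (q * T * p) h)) ∈ {X : Set (H × H) |
        (∀ p ∈ X, p.1 ∈ W ∧ p.2 ∈ V) ∧ (∀ c ∈ M.commutant, ∀ p ∈ X, (c p.1, c p.2) ∈ X) ∧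
        ∀ p ∈ X, ∀ q ∈ X, ⟪p.1, q.1⟫ = ⟪p.2, q.2⟫} := by
      have hcross : ∀ r ∈ X, ∀ h, ⟪r.1, a h⟫ = 0 ∧ ⟪r.2, (q * T * p) h⟫ = 0 := fun r hr h =>
        ⟨(haW h).2 _ (subset_cspan ⟨r, hr, rfl⟩), (hqV _).2 _ (subset_cspan ⟨r, hr, rfl⟩)⟩
      refine ⟨?_, ?_, ?_⟩
      · rintro r (hr | ⟨h, rfl⟩)
        · exact hXWV r hr
        · exact ⟨(haW h).1, (hqV _).1⟩
      · rintro c hc r (hr | hr)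
        · exact Or.inl (hXc c hc r hr)
        · exact Or.inr (commutant_abs_pair hS haM hc r hr)
      · rintro r (hr | ⟨h, rfl⟩) s (hs | ⟨k, rfl⟩)
        · exact hXin r hr s hs
        · rw [(hcross r hr k).1, (hcross r hr k).2]
        · rw [← inner_conj_symm, ← inner_conj_symm ((q * T * p) h), (hcross s hs h).1,
            (hcross s hs h).2]
        · exact ha h k
    have hle : (a x, (q * T * p) x) ∈ X := hX.le_of_ge hmem Set.subset_union_left (Or.inr ⟨x, rfl⟩)
    have h0 : (q * T * p) x = 0 := by
      rw [← inner_self_eq_zero (𝕜 := ℂ)]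
      exact (hqV _).2 _ (subset_cspan ⟨_, hle, rfl⟩)
    have h0' : q (T x) = 0 := by rw [← hpf x hx]; exact h0
    rw [← hqf y hy, ← star_inner_left, hqs, h0', inner_zero_left]
  obtain ⟨z, hz, hz1, hz0⟩ := exists_separating hW₂ hdisj
  obtain ⟨v, hvM, hvX, hviso, hvV, -⟩ := exists_partialIsometry (M := M) X hXc hXin
  obtain ⟨w, hwM, hwX, hwiso, hwV, -⟩ := exists_partialIsometry (M := M) (Prod.swap '' X)
    (by rintro c hc _ ⟨p, hp, rfl⟩; exact ⟨_, hXc c hc p hp, rfl⟩)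
    (by rintro _ ⟨p, hp, rfl⟩ _ ⟨q, hq, rfl⟩; exact (hXin p hp q hq).symm)
  simp only [← Set.image_comp] at hwiso hwV
  have hU₁W : cspan (Prod.fst '' X) ≤ W := cspan_le hW.closed (by
    rintro _ ⟨p, hp, rfl⟩; exact (hXWV p hp).1)
  have hU₂V : cspan (Prod.snd '' X) ≤ V := cspan_le hV.closed (by
    rintro _ ⟨p, hp, rfl⟩; exact (hXWV p hp).2)
  refine ⟨z, hz, ⟨w, hwM, fun x hx => ⟨hwiso x ?_, ?_⟩⟩, ⟨v, hvM, fun x hx => ⟨hviso x ?_, ?_⟩⟩⟩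
  · refine (hz.isAffiliated_cut hU₂).mem_of_orthogonal (W := cut z V) ?_ ?_ hx |>.1
    · exact fun y hy => mem_cut.2 ⟨hU₂V hy.1, (mem_cut.1 hy).2⟩
    · intro r hr hr'
      have : r ∈ V ⊓ (cspan (Prod.snd '' X))ᗮ := ⟨hr.1, fun u hu => by
        rw [← (mem_cut.1 hr).2, ← hz.inner_apply]
        exact hr' _ (hz.apply_mem hU₂ hu)⟩
      have h0 := hz0 r this
      rw [(mem_cut.1 hr).2] at h0
      rw [h0]
      exact Submodule.zero_mem _
  · exact hU₁W (hwV x)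
  · refine (hz.compl.isAffiliated_cut hU₁).mem_of_orthogonal (W := cut (1 - z) W) ?_ ?_ hx |>.1
    · exact fun y hy => mem_cut.2 ⟨hU₁W hy.1, (mem_cut.1 hy).2⟩
    · intro r hr hr'
      have : r ∈ W ⊓ (cspan (Prod.fst '' X))ᗮ := ⟨hr.1, fun u hu => by
        rw [← (mem_cut.1 hr).2, ← hz.compl.inner_apply]
        exact hr' _ (hz.compl.apply_mem hU₁ hu)⟩
      have h1 := hz1 r this
      have h2 := (mem_cut.1 hr).2
      change r - z r = r at h2
      rw [h1, sub_self] at h2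
      rw [← h2]
      exact Submodule.zero_mem _
  · exact hU₂V (hvV x)


lemma norm_add_eq_norm_add {a b a' b' : H} (h : ⟪a, b⟫ = 0) (h' : ⟪a', b'⟫ = 0)
    (ha : ‖a'‖ = ‖a‖) (hb : ‖b'‖ = ‖b‖) : ‖a' + b'‖ = ‖a + b‖ := by
  have h1 := norm_add_sq_eq_norm_sq_add_norm_sq_of_inner_eq_zero a b h
  have h2 := norm_add_sq_eq_norm_sq_add_norm_sq_of_inner_eq_zero a' b' h'
  rw [ha, hb, ← h1] at h2
  nlinarith [norm_nonneg (a + b), norm_nonneg (a' + b')]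

lemma IsCentralProj.inner_compl {z : H →L[ℂ] H} (hz : IsCentralProj M z) (x y : H) :
    ⟪z x, y - z y⟫ = 0 := by
  rw [hz.inner_apply, map_sub, hz.apply_apply, sub_self, inner_zero_right]

lemma Emb.of_cut {z : H →L[ℂ] H} {W V : Submodule ℂ H} (hz : IsCentralProj M z)
    (hW : IsAffiliated M W)
    (h₁ : Emb M (VonNeumannAlgebra.cut z W) V) (h₂ : Emb M (VonNeumannAlgebra.cut (1 - z) W) V) :
    Emb M W V := by
  obtain ⟨v, hv, hv'⟩ := h₁
  obtain ⟨w, hw, hw'⟩ := h₂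
  refine ⟨v * z + w * (1 - z), add_mem (mul_mem hv hz.mem) (mul_mem hw hz.compl.mem),
    fun x hx => ?_⟩
  have h1 := hv' _ (hz.apply_mem hW hx)
  have h2 := hw' _ (hz.compl.apply_mem hW hx)
  refine ⟨?_, V.add_mem h1.2 h2.2⟩
  have h3 : ⟪v (z x), w (x - z x)⟫ = 0 := by
    have : w (x - z x) = w x - z (w x) := by rw [map_sub, hz.apply_comm hw]
    rw [this, ← hz.apply_apply x, ← hz.apply_comm hv, hz.inner_compl]
  have h4 := norm_add_eq_norm_add (hz.inner_compl x x) h3 h1.1 h2.1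
  rwa [add_sub_cancel] at h4

/-- Finiteness of the projection onto `K`. -/
def IsFin (M : VonNeumannAlgebra H) (K : Submodule ℂ H) : Prop :=
  ∀ w ∈ M, (∀ x ∈ K, ‖w x‖ = ‖x‖ ∧ w x ∈ K) → ∀ y ∈ K, (∀ x ∈ K, ⟪w x, y⟫ = 0) → y = 0

/-- The complement in `K` of the range of a partial isometry. -/
noncomputable def coRange (K : Submodule ℂ H) (f : H →L[ℂ] H) : Submodule ℂ H :=
  K ⊓ LinearMap.ker ((star f : H →L[ℂ] H) : H →ₗ[ℂ] H)

lemma mem_coRange {K : Submodule ℂ H} {f : H →L[ℂ] H} {x : H} :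
    x ∈ coRange K f ↔ x ∈ K ∧ star f x = 0 := Iff.rfl

lemma IsPartialIsom.sub_mem_coRange {f : H →L[ℂ] H} {E K : Submodule ℂ H}
    (hf : IsPartialIsom M f E K) {x : H} (hx : x ∈ K) : x - f (star f x) ∈ coRange K f :=
  ⟨K.sub_mem hx (hf.map_mem _), by
    change star f (x - f (star f x)) = 0
    rw [map_sub, hf.map_star_map, sub_self]⟩

lemma inner_of_mem_coRange {K : Submodule ℂ H} {f : H →L[ℂ] H} {y : H} (hy : y ∈ coRange K f)
    (x : H) : ⟪f x, y⟫ = 0 := by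
  rw [← star_inner_right, (mem_coRange.1 hy).2, inner_zero_right]

lemma IsAffiliated.coRange {K : Submodule ℂ H} {f : H →L[ℂ] H} (hK : IsAffiliated M K)
    (hf : f ∈ M) : IsAffiliated M (coRange K f) :=
  hK.inf (isAffiliated_ker (star_mem hf))

lemma IsPartialIsom.norm_star {f : H →L[ℂ] H} {E K : Submodule ℂ H}
    (hf : IsPartialIsom M f E K) (x : H) : ‖star f x‖ = ‖f (star f x)‖ :=
  (hf.norm_map (hf.star_mem x)).symm

/-- Cancellation: in a finite `K`, complements of equivalent subspaces are comparable. -/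
theorem IsFin.emb_coRange {K E : Submodule ℂ H} (hK : IsAffiliated M K) (hfin : IsFin M K)
    {f g : H →L[ℂ] H} (hf : IsPartialIsom M f E K) (hg : IsPartialIsom M g E K) :
    Emb M (coRange K g) (coRange K f) := by
  have hA := hK.coRange hf.mem
  have hC := hK.coRange hg.mem
  obtain ⟨z, hz, h1, h2⟩ := comparison hC hA
  refine Emb.of_cut hz hC ?_ h2
  have hzz : cut z (cut z (coRange K f)) = cut z (coRange K f) := by
    ext x; simp only [mem_cut]; tauto
  have h1 := h1.cut hz
  rw [hzz] at h1
  obtain ⟨h, hh⟩ := h1.exists_isPartialIsom (hz.isAffiliated_cut hA)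
  have hsurj : ∀ y ∈ cut z (coRange K g), h (star h y) = y := by
    intro y hy
    have hy' : y - h (star h y) ∈ cut z (coRange K g) :=
      Submodule.sub_mem _ hy (hh.map_mem _)
    have hort : ∀ x, ⟪h x, y - h (star h y)⟫ = 0 := fun x => by
      rw [← star_inner_right, map_sub, hh.map_star_map, sub_self, inner_zero_right]
    have hwM : z * (g * star f + h) + (1 - z) ∈ M :=
      add_mem (mul_mem hz.mem (add_mem (mul_mem hg.mem (star_mem hf.mem)) hh.mem)) hz.compl.mem
    have hw : ∀ x, (z * (g * star f + h) + (1 - z)) x =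
        z (g (star f x) + h x) + (x - z x) := fun x => rfl
    symm
    rw [← sub_eq_zero]
    refine hfin _ hwM (fun x hx => ⟨?_, ?_⟩) _ hy'.1.1 fun x hx => ?_
    · rw [hw]
      have e1 : ‖z (g (star f x) + h x)‖ = ‖z x‖ := by
        have ha := hz.apply_mem hA (hf.sub_mem_coRange hx)
        set a := z (x - f (star f x)) with ha'
        have e2 : h x = h a := by
          rw [← sub_eq_zero, ← map_sub]
          refine hh.map_eq_zero _ fun u hu => ?_
          have hu2 := mem_cut.1 hu
          rw [← hu2.2, inner_sub_right, hz.inner_apply, hz.inner_apply, ha', hz.apply_apply,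
            ← inner_sub_right, ← map_sub, sub_sub_cancel, ← hz.inner_apply, hu2.2,
            ← inner_conj_symm, inner_of_mem_coRange hu2.1, map_zero]
        have e3 : z (h a) = h a := (mem_cut.1 (hh.map_mem a)).2
        have e4 : z x = z (f (star f x)) + a := by rw [ha', ← map_add, add_sub_cancel]
        rw [map_add, e2, e3, e4]
        refine norm_add_eq_norm_add ?_ ?_ ?_ (hh.norm_map ha)
        · rw [hz.apply_comm hf.mem]
          exact inner_of_mem_coRange (mem_cut.1 ha).1 _
        · rw [hz.apply_comm hg.mem]
          exact inner_of_mem_coRange (mem_cut.1 (hh.map_mem a)).1 _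
        · rw [hz.apply_comm hg.mem, hz.apply_comm hf.mem, hz.apply_comm (star_mem hf.mem),
            hg.norm_map (hf.star_mem _), hf.norm_map (hf.star_mem _)]
      have := norm_add_eq_norm_add (hz.inner_compl x x)
        (by rw [hz.inner_compl]) e1 (rfl : ‖x - z x‖ = _)
      rwa [add_sub_cancel] at this
    · refine K.add_mem (hK.inv z hz.mem_commutant _ (K.add_mem (hg.map_mem _)
        (hh.map_mem _).1.1)) (K.sub_mem hx (hK.inv z hz.mem_commutant _ hx))
    · rw [hw]
      have hzy := (mem_cut.1 hy').2
      rw [inner_add_left, hz.inner_apply, hzy, inner_add_left, hort,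
        inner_of_mem_coRange (mem_cut.1 hy').1, ← hzy, inner_sub_left, hz.inner_apply,
        hz.apply_apply, sub_self, add_zero, add_zero]
  refine ⟨star h, star_mem hh.mem, fun y hy => ⟨?_, (hh.star_mem y).1⟩⟩
  rw [hh.norm_star, hsurj y hy]

/-- Isometries into a finite `K` can be extended. -/
theorem IsFin.exists_extension {K E E' : Submodule ℂ H} (hK : IsAffiliated M K)
    (hfin : IsFin M K) (hE : IsAffiliated M E) (hE' : IsAffiliated M E') (hEE : E ≤ E')
    {f : H →L[ℂ] H} (hf : IsPartialIsom M f E K) (h : Emb M E' K) :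
    ∃ f', IsPartialIsom M f' E' K ∧ ∀ x ∈ E, f' x = f x := by
  obtain ⟨g, hg⟩ := h.exists_isPartialIsom hE'
  obtain ⟨g₁, hg₁, hgg⟩ := exists_isPartialIsom hE hg.mem fun x hx =>
    ⟨hg.norm_map (hEE hx), hg.map_mem x⟩
  obtain ⟨u, hu, hu'⟩ := hfin.emb_coRange hK hf hg₁
  obtain ⟨p, hpM, hps, hpW, hpf, hpo, hp0⟩ := hE.exists_proj
  have hmem : ∀ x ∈ E', g (x - p x) ∈ coRange K g₁ := fun x hx => by
    refine ⟨hg.map_mem _, hg₁.star_eq_zero fun e he => ?_⟩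
    rw [hgg e he, hg.inner_map (hEE he), hpo _ _ he]
  obtain ⟨f', hf', hff⟩ := exists_isPartialIsom (v := f * p + u * g * (1 - p)) (V := K) hE'
    (add_mem (mul_mem hf.mem hpM) (mul_mem (mul_mem hu hg.mem) (sub_mem (one_mem _) hpM)))
    (fun x hx => by
      change ‖f (p x) + u (g (x - p x))‖ = _ ∧ f (p x) + u (g (x - p x)) ∈ K
      have h1 := hu' _ (hmem x hx)
      refine ⟨?_, K.add_mem (hf.map_mem _) h1.2.1⟩
      have := norm_add_eq_norm_add (hpo x (p x) (hpW x)) (inner_of_mem_coRange h1.2 (p x))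
        (hf.norm_map (hpW x)) (h1.1.trans (hg.norm_map (E'.sub_mem hx (hEE (hpW x)))))
      rwa [add_sub_cancel] at this)
  refine ⟨f', hf', fun x hx => ?_⟩
  rw [hff x (hEE hx)]
  change f (p x) + u (g (x - p x)) = f x
  rw [hpf x hx, sub_self, map_zero, map_zero, add_zero]

/-- Maps `e i x ↦ f i x` with compatible inner products can be glued. -/
theorem exists_glue {ι : Type*} {W : ι → Submodule ℂ H} {e f : ι → H →L[ℂ] H}
    (hW : ∀ i, IsAffiliated M (W i)) (he : ∀ i, e i ∈ M) (hf : ∀ i, f i ∈ M)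
    (h : ∀ i j, ∀ x ∈ W i, ∀ y ∈ W j, ⟪e i x, e j y⟫ = ⟪f i x, f j y⟫) :
    ∃ v ∈ M, (∀ x ∈ cspan {y | ∃ i, ∃ x ∈ W i, e i x = y}, ‖v x‖ = ‖x‖) ∧
      ∀ x, v x ∈ cspan {y | ∃ i, ∃ x ∈ W i, f i x = y} := by
  obtain ⟨v, hvM, -, hv2, hv3, -⟩ := exists_partialIsometry (M := M)
    {p : H × H | ∃ i, ∃ x ∈ W i, p = (e i x, f i x)}
    (by
      rintro c hc p ⟨i, x, hx, rfl⟩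
      exact ⟨i, c x, (hW i).inv c hc _ hx, by simp only [apply_comm (hf i) hc,
        apply_comm (he i) hc]⟩)
    (by
      rintro p ⟨i, x, hx, rfl⟩ q ⟨j, y, hy, rfl⟩
      exact h i j _ hx _ hy)
  refine ⟨v, hvM, fun x hx => hv2 x ?_, fun x => ?_⟩
  · refine cspan_le (isClosed_cspan _) ?_ hx
    rintro _ ⟨i, y, hy, rfl⟩
    exact subset_cspan ⟨(e i y, f i y), ⟨i, y, hy, rfl⟩, rfl⟩
  · refine cspan_le (isClosed_cspan _) ?_ (hv3 x)
    rintro _ ⟨p, ⟨i, y, hy, rfl⟩, rfl⟩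
    exact subset_cspan ⟨i, y, hy, rfl⟩

lemma isAffiliated_cspan_iUnion {ι : Type*} {W : ι → Submodule ℂ H}
    (hW : ∀ i, IsAffiliated M (W i)) : IsAffiliated M (cspan {x | ∃ i, x ∈ W i}) :=
  isAffiliated_cspan (by
    rintro c hc x ⟨i, hx⟩
    exact ⟨i, (hW i).inv c hc x hx⟩)

/-- Subspaces that embed in a finite `K` are closed under increasing unions. -/
theorem IsFin.emb_iUnion {K : Submodule ℂ H} (hK : IsAffiliated M K) (hfin : IsFin M K)
    {E : ℕ → Submodule ℂ H} (hE : ∀ n, IsAffiliated M (E n)) (hmono : Monotone E)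
    (h : ∀ n, Emb M (E n) K) : Emb M (cspan {x | ∃ n, x ∈ E n}) K := by
  obtain ⟨f₀, hf₀⟩ := (h 0).exists_isPartialIsom (hE 0)
  have hstep : ∀ n, ∀ f : {f // IsPartialIsom M f (E n) K},
      ∃ f' : {f // IsPartialIsom M f (E (n + 1)) K}, ∀ x ∈ E n, f'.1 x = f.1 x := by
    intro n f
    obtain ⟨f', hf', hff⟩ := hfin.exists_extension hK (hE n) (hE (n + 1))
      (hmono n.le_succ) f.2 (h (n + 1))
    exact ⟨⟨f', hf'⟩, hff⟩
  choose F hF using hstep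
  let g : ∀ n, {f // IsPartialIsom M f (E n) K} := fun n => Nat.rec ⟨f₀, hf₀⟩ F n
  have hg : ∀ n k, ∀ x ∈ E n, (g (n + k)).1 x = (g n).1 x := by
    intro n k x hx
    induction k with
    | zero => rfl
    | succ k ih =>
      rw [← ih]
      exact hF (n + k) (g (n + k)) x (hmono (Nat.le_add_right n k) hx)
  have hg' : ∀ n m, n ≤ m → ∀ x ∈ E n, (g m).1 x = (g n).1 x := by
    intro n m hnm x hx
    obtain ⟨k, rfl⟩ := Nat.exists_eq_add_of_le hnm
    exact hg n k x hx
  obtain ⟨v, hv, hv2, hv3⟩ := exists_glue (e := fun _ => 1) (f := fun n => (g n).1) hE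
    (fun _ => one_mem M) (fun n => (g n).2.mem)
    (fun i j x hx y hy => by
      rw [← hg' i (max i j) (le_max_left _ _) x hx, ← hg' j (max i j) (le_max_right _ _) y hy,
        (g _).2.inner_map (hmono (le_max_left _ _) hx)]
      rfl)
  refine ⟨v, hv, fun x hx => ⟨hv2 x (by simpa using hx), cspan_le hK.closed ?_ (hv3 x)⟩⟩
  rintro _ ⟨n, x, -, rfl⟩
  exact (g n).2.map_mem x

lemma cfc_mem {a : H →L[ℂ] H} (ha : a ∈ M) (f : ℝ → ℝ) : cfc f a ∈ M := by
  rw [← M.commutant_commutant, mem_commutant_iff]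
  intro c hc
  have h1 : Commute a c := mem_commutant_iff.1 hc _ ha
  exact (h1.cfc_real f).symm

theorem exists_spectral_exhaustion {a : H →L[ℂ] H} (ha : a ∈ M) (hpos : 0 ≤ a) :
    ∃ E : ℕ → Submodule ℂ H, (∀ k, IsAffiliated M (E k)) ∧ Monotone E ∧
      (∀ k, ∃ G : H →L[ℂ] H, ∀ x ∈ E k, x = a (G x)) ∧
      ∀ x, a x ∈ cspan {x | ∃ k, x ∈ E k} := by
  have hsa : IsSelfAdjoint a := hpos.isSelfAdjoint
  let φ : ℕ → ℝ → ℝ := fun k t => max (1 - (k + 1) * t) 0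
  have hφ : ∀ k, Continuous (φ k) := fun k => by fun_prop
  have hk : ∀ k : ℕ, (0 : ℝ) < k + 1 := fun k => by positivity
  refine ⟨fun k => LinearMap.ker ((cfc (φ k) a : H →L[ℂ] H) : H →ₗ[ℂ] H),
    fun k => isAffiliated_ker (cfc_mem ha _), monotone_nat_of_le_succ fun k x hx => ?_,
    fun k => ?_, fun x => ?_⟩
  · let q : ℝ → ℝ := fun t => φ (k + 1) t / max (1 - (k + 1) * t) (1 / (k + 2))
    have hq : Continuous q := by
      refine (hφ _).div₀ (by fun_prop) fun t => ?_
      have : (0 : ℝ) < 1 / (k + 2) := by positivity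
      exact (lt_max_of_lt_right this).ne'
    have h1 : cfc (φ (k + 1)) a = cfc q a * cfc (φ k) a := by
      rw [← cfc_mul q (φ k) a hq.continuousOn (hφ k).continuousOn]
      congr 1
      ext t
      simp only [q, φ, Nat.cast_add, Nat.cast_one]
      have hk1 := hk k
      rcases le_total 0 (1 - ((k : ℝ) + 1 + 1) * t) with h | h
      · have h2 : 1 / ((k : ℝ) + 2) ≤ 1 - (k + 1) * t := by
          have : t ≤ 1 / (k + 2) := by
            rw [le_div_iff₀ (by positivity)]; linarith
          have h3 : ((k : ℝ) + 1) * t ≤ (k + 1) * (1 / (k + 2)) := by gcongr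
          have h4 : ((k : ℝ) + 1) * (1 / (k + 2)) = 1 - 1 / (k + 2) := by field_simp; ring
          linarith
        have h3 : (0 : ℝ) < 1 / (k + 2) := by positivity
        rw [max_eq_left h, max_eq_left h2, max_eq_left (by linarith)]
        rw [div_mul_cancel₀]
        linarith
      · rw [max_eq_right h]; simp
    have hx : cfc (φ k) a x = 0 := hx
    change cfc (φ (k + 1)) a x = 0
    rw [h1]
    change cfc q a (cfc (φ k) a x) = 0
    rw [hx, map_zero]
  · let g : ℝ → ℝ := fun t => (max t (1 / (k + 1)))⁻¹
    have hg : Continuous g := by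
      refine Continuous.inv₀ (by fun_prop) fun t => ?_
      have : (0 : ℝ) < 1 / (k + 1) := by positivity
      exact (lt_max_of_lt_right this).ne'
    have h1 : cfc (φ k) a = 1 - a * cfc g a := by
      have h2 : φ k = fun t => 1 - t * g t := by
        ext t
        simp only [φ, g]
        have hk1 := hk k
        rcases le_total t (1 / (k + 1)) with h | h
        · rw [max_eq_right h, max_eq_left]
          · field_simp
          · rw [le_div_iff₀ hk1] at h; linarith
        · have ht : 0 < t := lt_of_lt_of_le (by positivity) h
          rw [max_eq_left h, max_eq_right, mul_inv_cancel₀ ht.ne', sub_self]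
          rw [div_le_iff₀ hk1] at h; linarith
      rw [h2, cfc_sub (fun _ => (1 : ℝ)) (fun t => t * g t) a (by fun_prop) (by fun_prop),
        cfc_mul (fun t => t) g a (by fun_prop) hg.continuousOn, cfc_id' ℝ a, cfc_const_one ℝ a]
    refine ⟨cfc g a, fun x hx => ?_⟩
    have hx : cfc (φ k) a x = 0 := hx
    rw [h1] at hx
    exact sub_eq_zero.1 hx
  · let ψ : ℕ → ℝ → ℝ := fun k t => max (t - 1 / (k + 1)) 0
    have hψ : ∀ k, Continuous (ψ k) := fun k => by fun_prop
    have hlim : Tendsto (fun k => cfc (ψ k) a x) atTop (nhds (a x)) := by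
      rw [tendsto_iff_norm_sub_tendsto_zero]
      refine squeeze_zero (g := fun k : ℕ => 1 / ((k : ℝ) + 1) * ‖x‖) (fun k => norm_nonneg _)
        (fun k => ?_) ?_
      · have h1 : cfc (ψ k) a x - a x = (cfc (fun t => ψ k t - t) a) x := by
          rw [cfc_sub (ψ k) (fun t => t) a (hψ k).continuousOn (by fun_prop), cfc_id' ℝ a]
          rfl
        rw [h1]
        refine ContinuousLinearMap.le_of_opNorm_le _ (norm_cfc_le (by positivity) ?_) _
        intro t ht
        have ht0 : 0 ≤ t := spectrum_nonneg_of_nonneg hpos ht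
        have hk1 : 0 < 1 / ((k : ℝ) + 1) := by positivity
        rw [Real.norm_eq_abs, abs_le]
        simp only [ψ]
        rcases le_total (t - 1 / ((k : ℝ) + 1)) 0 with h | h
        · rw [max_eq_right h]; constructor <;> linarith
        · rw [max_eq_left h]; constructor <;> linarith
      · simpa using tendsto_one_div_add_atTop_nhds_zero_nat.mul_const ‖x‖
    refine (isClosed_cspan _).mem_of_tendsto hlim (Eventually.of_forall fun k => ?_)
    refine subset_cspan ⟨k, ?_⟩
    change cfc (φ k) a (cfc (ψ k) a x) = 0
    have : cfc (φ k) a * cfc (ψ k) a = 0 := by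
      rw [← cfc_mul (φ k) (ψ k) a (hφ k).continuousOn (hψ k).continuousOn, ← cfc_zero ℝ a]
      congr 1
      ext t
      simp only [φ, ψ, Pi.zero_apply, mul_eq_zero]
      have hk1 := hk k
      rcases le_total t (1 / (k + 1)) with h | h
      · right
        rw [max_eq_right]; linarith
      · left
        rw [max_eq_right]
        rw [div_le_iff₀ hk1] at h; linarith
    exact DFunLike.congr_fun this x

/-- The sequences `(g, T 0 (S g), T 1 (S g), …)` in `ℓ²`. -/
noncomputable def graphSpace (T : ℕ → H →L[ℂ] H) (S : H →L[ℂ] H) :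
    Submodule ℂ (lp (fun _ : ℕ => H) 2) where
  carrier := {f | ∀ n, f (n + 1) = T n (S (f 0))}
  add_mem' := fun {f g} hf hg n => by
    change f (n + 1) + g (n + 1) = T n (S (f 0 + g 0))
    rw [hf, hg, map_add, map_add]
  zero_mem' := fun n => by
    change (0 : H) = T n (S 0)
    rw [map_zero, map_zero]
  smul_mem' := fun c f hf n => by
    change c • f (n + 1) = T n (S (c • f 0))
    rw [hf, map_smul, map_smul]

theorem exists_graph_operator {T : ℕ → H →L[ℂ] H} {S : H →L[ℂ] H} (hT : ∀ n, T n ∈ M)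
    (hS : S ∈ M) :
    ∃ a ∈ M, 0 ≤ a ∧
      (∃ C : ℝ, ∀ y, ∃ g, a y = S g ∧ ‖g‖ ≤ C * ‖y‖ ∧ ∀ n, ‖T n (S g)‖ ≤ C * ‖y‖) ∧
      ∀ h, Summable (fun n => ‖T n (S h)‖ ^ 2) → ∀ y, a y = 0 → ⟪y, S h⟫ = 0 := by
  have hev : ∀ n, Continuous fun f : lp (fun _ : ℕ => H) 2 => f n := fun n =>
    (lp.lipschitzWith_one_eval 2 n).continuous
  have hcl : IsClosed (graphSpace T S : Set (lp (fun _ : ℕ => H) 2)) := by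
    have : (graphSpace T S : Set (lp (fun _ : ℕ => H) 2)) =
        ⋂ n, {f | f (n + 1) = T n (S (f 0))} := by
      ext f; simp [graphSpace]
    rw [this]
    exact isClosed_iInter fun n => isClosed_eq (hev _)
      ((T n).continuous.comp (S.continuous.comp (hev 0)))
  have : CompleteSpace (graphSpace T S) := hcl.completeSpace_coe
  let e₀ : graphSpace T S →L[ℂ] H := LinearMap.mkContinuous
    { toFun := fun f => (f : lp (fun _ : ℕ => H) 2) 0
      map_add' := fun _ _ => rfl
      map_smul' := fun _ _ => rfl } 1
    fun f => by
      rw [one_mul]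
      exact lp.norm_apply_le_norm two_ne_zero (f : lp (fun _ : ℕ => H) 2) 0
  let j : graphSpace T S →L[ℂ] H := S.comp e₀
  have hj : ∀ f : graphSpace T S, j f = S ((f : lp (fun _ : ℕ => H) 2) 0) := fun _ => rfl
  have hact : ∀ c ∈ M.commutant, ∀ f : graphSpace T S, ∃ f' : graphSpace T S,
      ∀ n, (f' : lp (fun _ : ℕ => H) 2) n = c ((f : lp (fun _ : ℕ => H) 2) n) := by
    intro c hc f
    have hmem : Memℓp (fun n => c ((f : lp (fun _ : ℕ => H) 2) n)) 2 := by
      have h1 := (lp.memℓp (f : lp (fun _ : ℕ => H) 2)).summable (by norm_num)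
      refine memℓp_gen (Summable.of_nonneg_of_le (fun n => by positivity) (fun n => ?_)
        (h1.mul_left (‖c‖ ^ 2)))
      simp only [ENNReal.toReal_ofNat, Real.rpow_ofNat]
      rw [← mul_pow]
      gcongr
      exact c.le_opNorm _
    exact ⟨⟨⟨_, hmem⟩, fun n => by
      change c _ = T n (S (c _))
      rw [f.2 n, apply_comm (hT n) hc, apply_comm hS hc]⟩, fun n => rfl⟩
  have hadj : ∀ y (f : graphSpace T S), ⟪j.adjoint y, f⟫ = ⟪y, j f⟫ := fun y f =>
    ContinuousLinearMap.adjoint_inner_left j f y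
  refine ⟨j.comp j.adjoint, ?_, ?_, ⟨‖j.adjoint‖, fun y => ?_⟩, fun h hh y hy => ?_⟩
  · refine mem_of_forall_commutant fun c hc x => ?_
    obtain ⟨f', hf'⟩ := hact c hc (j.adjoint x)
    have h1 : f' = j.adjoint (c x) := by
      refine ext_inner_right ℂ fun f => ?_
      obtain ⟨k, hk⟩ := hact (star c) (star_mem hc) f
      rw [hadj, ← star_inner_right, hj, apply_comm hS (star_mem hc), ← hk, ← hj, ← hadj]
      rw [Submodule.coe_inner, Submodule.coe_inner, lp.inner_eq_tsum, lp.inner_eq_tsum]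
      refine tsum_congr fun n => ?_
      rw [hf', hk, star_inner_right]
    change c (j (j.adjoint x)) = j (j.adjoint (c x))
    rw [← h1, hj, hj, hf', apply_comm hS hc]
  · rw [ContinuousLinearMap.nonneg_iff_isPositive]
    exact ContinuousLinearMap.isPositive_self_comp_adjoint j
  · have hle : ∀ n, ‖(j.adjoint y : lp (fun _ : ℕ => H) 2) n‖ ≤ ‖j.adjoint‖ * ‖y‖ := fun n =>
      (lp.norm_apply_le_norm two_ne_zero (j.adjoint y : lp (fun _ : ℕ => H) 2) n).trans
        (j.adjoint.le_opNorm y)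
    refine ⟨(j.adjoint y : lp (fun _ : ℕ => H) 2) 0, rfl, hle 0, fun n => ?_⟩
    rw [← (j.adjoint y).2 n]
    exact hle _
  · have h0 : j.adjoint y = 0 := by
      rw [← inner_self_eq_zero (𝕜 := ℂ), hadj]
      change j (j.adjoint y) = 0 at hy
      rw [hy, inner_zero_right]
    let s : ℕ → H := fun n => Nat.casesOn n h fun n => T n (S h)
    have hmem : Memℓp s 2 := by
      refine memℓp_gen ?_
      simp only [ENNReal.toReal_ofNat, Real.rpow_ofNat]
      exact (summable_nat_add_iff 1).1 hh
    have := hadj y ⟨⟨s, hmem⟩, fun n => rfl⟩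
    rw [h0, inner_zero_left] at this
    exact this.symm

/-- An exhaustion of the vectors `S h` on whose pieces the `T n` are uniformly bounded. -/
theorem exists_egorov {T : ℕ → H →L[ℂ] H} {S : H →L[ℂ] H} (hT : ∀ n, T n ∈ M) (hS : S ∈ M)
    {h : ℕ → H} (hh : ∀ i, Summable (fun n => ‖T n (S (h i))‖ ^ 2)) :
    ∃ E : ℕ → Submodule ℂ H, (∀ k, IsAffiliated M (E k)) ∧ Monotone E ∧
      (∀ k, ∃ C : ℝ, ∀ x ∈ E k, ‖x‖ ≤ C * ‖star S x‖ ∧ ∀ n, ‖T n x‖ ≤ C * ‖x‖) ∧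
      ∀ i, S (h i) ∈ cspan {x | ∃ k, x ∈ E k} := by
  obtain ⟨a, ha, hpos, ⟨C, hC⟩, hker⟩ := exists_graph_operator hT hS
  obtain ⟨E, hE, hmono, hG, hran⟩ := exists_spectral_exhaustion ha hpos
  refine ⟨E, hE, hmono, fun k => ?_, fun i => ?_⟩
  · obtain ⟨G, hG⟩ := hG k
    refine ⟨max C 0 * ‖G‖, fun x hx => ?_⟩
    obtain ⟨g, hg, hg1, hg2⟩ := hC (G x)
    have hle : C * ‖G x‖ ≤ max C 0 * ‖G‖ * ‖x‖ := by
      rw [mul_assoc]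
      exact mul_le_mul (le_max_left _ _) (G.le_opNorm x) (norm_nonneg _) (le_max_right _ _)
    rw [← hG x hx] at hg
    refine ⟨?_, fun n => ?_⟩
    · have h1 : ‖x‖ * ‖x‖ ≤ ‖star S x‖ * (max C 0 * ‖G‖ * ‖x‖) := by
        calc ‖x‖ * ‖x‖ = ‖⟪star S x, g⟫‖ := by
              rw [star_inner_left, ← hg, inner_self_eq_norm_sq_to_K]; simp [sq]
          _ ≤ ‖star S x‖ * ‖g‖ := norm_inner_le_norm _ _
          _ ≤ _ := by gcongr; exact hg1.trans hle
      rcases (norm_nonneg x).eq_or_lt with h0 | h0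
      · rw [← h0]; positivity
      · refine le_of_mul_le_mul_right ?_ h0
        linarith
    · have := hg2 n
      rw [← hg] at this
      exact this.trans hle
  · obtain ⟨p, hpM, hps, hpW, hpf, hpo, hp0⟩ := (isAffiliated_cspan_iUnion hE).exists_proj
    set y := S (h i) - p (S (h i)) with hy
    have hay : a y = 0 := by
      refine ext_inner_left ℂ fun x => ?_
      have hsa : star a = a := hpos.isSelfAdjoint
      rw [← hsa, star_inner_right, hpo _ _ (hran x), inner_zero_right]
    have h1 := hker (h i) (hh i) y hay
    have h2 : ⟪y, p (S (h i))⟫ = 0 := by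
      rw [← inner_conj_symm, hpo _ _ (hpW _), map_zero]
    have h3 : y = 0 := by
      rw [← inner_self_eq_zero (𝕜 := ℂ)]
      nth_rw 2 [hy]
      rw [inner_sub_right, h1, h2, sub_zero]
    rw [sub_eq_zero.1 h3]
    exact hpW _

/-- The `Bn n` converge to `B` and their ranges embed in `K`. -/
structure IsApprox (M : VonNeumannAlgebra H) (K : Submodule ℂ H) (B : H →L[ℂ] H)
    (Bn : ℕ → H →L[ℂ] H) : Prop where
  mem : B ∈ M
  mem_seq : ∀ n, Bn n ∈ M
  emb : ∀ n, ∃ v ∈ M, ∀ x, ‖v (Bn n x)‖ = ‖Bn n x‖ ∧ v (Bn n x) ∈ K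
  tendsto : ∀ x, Tendsto (fun n => star (Bn n) x) atTop (nhds (star B x))

/-- Operators into `K` that detect the kernels of the `star (Bn n)`. -/
lemma IsApprox.exists_ker {K : Submodule ℂ H} {B : H →L[ℂ] H} {Bn : ℕ → H →L[ℂ] H}
    (h : IsApprox M K B Bn) (n : ℕ) :
    ∃ R ∈ M, (∀ x, R x ∈ K) ∧ ∀ x, R x = 0 → star (Bn n) x = 0 := by
  obtain ⟨v, hv, hv'⟩ := h.emb n
  refine ⟨v * Bn n * star (Bn n), mul_mem (mul_mem hv (h.mem_seq n)) (star_mem (h.mem_seq n)),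
    fun x => (hv' _).2, fun x hx => ?_⟩
  have h1 : v (Bn n (star (Bn n) x)) = 0 := hx
  have h2 : Bn n (star (Bn n) x) = 0 := by
    rw [← norm_eq_zero, ← (hv' _).1, h1, norm_zero]
  rw [← inner_self_eq_zero (𝕜 := ℂ), star_inner_left, h2, inner_zero_right]

theorem IsApprox.exists_emb {K : Submodule ℂ H} {B : H →L[ℂ] H} {Bn : ℕ → H →L[ℂ] H}
    (h : IsApprox M K B Bn) (hK : IsAffiliated M K) (hfin : IsFin M K) (a : ℕ → H) :
    ∃ V, IsAffiliated M V ∧ Emb M V K ∧ ∀ i, B (a i) ∈ V := by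
  have hex : ∀ j : ℕ, ∃ n, ∀ i ≤ j, ‖star (Bn n) (B (a i)) - star B (B (a i))‖ ≤ (1 / 4) ^ j := by
    intro j
    have : ∀ᶠ n in atTop, ∀ i ∈ Finset.range (j + 1),
        ‖star (Bn n) (B (a i)) - star B (B (a i))‖ ≤ (1 / 4) ^ j := by
      rw [Filter.eventually_all_finset]
      intro i _
      have h1 := (tendsto_iff_norm_sub_tendsto_zero.1 (h.tendsto (B (a i))))
      exact h1.eventually_le_const (by positivity)
    obtain ⟨n, hn⟩ := this.exists
    exact ⟨n, fun i hi => hn i (Finset.mem_range.2 (Nat.lt_succ_of_le hi))⟩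
  choose φ hφ using hex
  let T : ℕ → H →L[ℂ] H := fun j => (2 : ℂ) ^ j • (star (Bn (φ j)) - star B)
  have hTn : ∀ j x, ‖T j x‖ = 2 ^ j * ‖star (Bn (φ j)) x - star B x‖ := fun j x => by
    change ‖(2 : ℂ) ^ j • (star (Bn (φ j)) x - star B x)‖ = _
    rw [norm_smul, norm_pow]
    simp
  have hT : ∀ j, T j ∈ M := fun j => mem_of_forall_commutant fun c hc x => by
    change c ((2 : ℂ) ^ j • (star (Bn (φ j)) x - star B x)) =
      (2 : ℂ) ^ j • (star (Bn (φ j)) (c x) - star B (c x))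
    rw [map_smul, map_sub, apply_comm (star_mem (h.mem_seq _)) hc,
      apply_comm (star_mem h.mem) hc]
  obtain ⟨E, hE, hmono, hC, hBa⟩ := exists_egorov hT h.mem (h := a) (fun i => by
    rw [← summable_nat_add_iff i]
    refine Summable.of_nonneg_of_le (fun n => by positivity) (fun n => ?_)
      (summable_geometric_of_lt_one (by norm_num : (0 : ℝ) ≤ 1 / 2) (by norm_num))
    have h1 := hφ (n + i) i (Nat.le_add_left _ _)
    have h2 : ‖T (n + i) (B (a i))‖ ≤ (1 / 2) ^ (n + i) := by
      rw [hTn]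
      calc (2 : ℝ) ^ (n + i) * _ ≤ 2 ^ (n + i) * (1 / 4) ^ (n + i) := by gcongr
        _ = (1 / 2) ^ (n + i) := by rw [← mul_pow]; norm_num
    have h3 : ((1 : ℝ) / 2) ^ (n + i) ≤ (1 / 2) ^ n :=
      pow_le_pow_of_le_one (by norm_num) (by norm_num) (Nat.le_add_right _ _)
    have h4 : ((1 : ℝ) / 2) ^ n ≤ 1 := pow_le_one₀ (by norm_num) (by norm_num)
    have h5 : (0 : ℝ) < (1 / 2) ^ n := by positivity
    nlinarith [norm_nonneg (T (n + i) (B (a i)))])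
  refine ⟨_, isAffiliated_cspan_iUnion hE, hfin.emb_iUnion hK hE hmono fun k => ?_, hBa⟩
  obtain ⟨C, hC⟩ := hC k
  obtain ⟨j, hj⟩ := pow_unbounded_of_one_lt (C * C) (one_lt_two (α := ℝ))
  obtain ⟨R, hR, hRK, hR0⟩ := h.exists_ker (φ j)
  refine emb_of_injOn (hE k) hK.closed hR (fun x _ => hRK x) fun x hx hx0 => ?_
  obtain ⟨h1, h2⟩ := hC x hx
  have h3 := h2 j
  rw [hTn, hR0 x hx0, zero_sub, norm_neg] at h3
  by_contra hne
  have hpos : 0 < ‖x‖ := norm_pos_iff.2 hne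
  have hC0 : 0 < C := by
    by_contra hC'
    nlinarith [norm_nonneg (star B x), not_lt.1 hC']
  have h4 : 2 ^ j * ‖x‖ ≤ C * C * ‖x‖ := by
    calc (2 : ℝ) ^ j * ‖x‖ ≤ 2 ^ j * (C * ‖star B x‖) := by gcongr
      _ = C * (2 ^ j * ‖star B x‖) := by ring
      _ ≤ C * (C * ‖x‖) := by gcongr
      _ = _ := by ring
  exact absurd (le_of_mul_le_mul_right h4 hpos) (not_le.2 hj)

lemma isClosed_coe : IsClosed (M : Set (H →L[ℂ] H)) := by
  rw [← M.centralizer_centralizer]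
  exact Set.isClosed_centralizer _

theorem exists_sum_of_orthogonal {K : Submodule ℂ H} (hK : IsClosed (K : Set H))
    {R : ℕ → H →L[ℂ] H} (hR : ∀ n, R n ∈ M) (hRK : ∀ n x, R n x ∈ K)
    (horth : ∀ m n, m ≠ n → ∀ x y, ⟪R m x, R n y⟫ = 0) :
    ∃ T ∈ M, (∀ x, T x ∈ K) ∧ ∀ x, T x = 0 → ∀ n, R n x = 0 := by
  let r : ℕ → ℝ := fun n => (1 / 2) ^ n / (1 + ‖R n‖)
  have hr : ∀ n, 0 < r n := fun n => by positivity
  have hsum : Summable fun n => (r n : ℂ) • R n := by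
    refine Summable.of_norm_bounded (g := fun n => (1 / 2 : ℝ) ^ n)
      (summable_geometric_of_lt_one (by norm_num) (by norm_num)) fun n => ?_
    rw [norm_smul, Complex.norm_real, Real.norm_of_nonneg (hr n).le]
    have : ‖R n‖ ≤ 1 + ‖R n‖ := by linarith
    calc r n * ‖R n‖ ≤ r n * (1 + ‖R n‖) := by gcongr
      _ = (1 / 2) ^ n := by simp only [r]; field_simp
  have happ : ∀ x, HasSum (fun n => (r n : ℂ) • R n x) ((∑' n, (r n : ℂ) • R n) x) := fun x =>
    hsum.hasSum.mapL (ContinuousLinearMap.apply ℂ H x)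
  refine ⟨∑' n, (r n : ℂ) • R n, ?_, fun x => ?_, fun x hx n => ?_⟩
  · refine isClosed_coe.mem_of_tendsto hsum.hasSum (Eventually.of_forall fun s => ?_)
    refine sum_mem fun n _ => mem_of_forall_commutant fun c hc x => ?_
    change c ((r n : ℂ) • R n x) = (r n : ℂ) • R n (c x)
    rw [map_smul, apply_comm (hR n) hc]
  · refine hK.mem_of_tendsto (happ x) (Eventually.of_forall fun s => ?_)
    exact K.sum_mem fun n _ => K.smul_mem _ (hRK n x)
  · have h1 := (happ x).mapL (innerSL ℂ (R n x))
    have h2 := hasSum_single (f := fun m => innerSL ℂ (R n x) ((r m : ℂ) • R m x)) n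
      (fun m hm => by
        rw [innerSL_apply_apply, inner_smul_right, horth n m hm.symm, mul_zero])
    have h3 := h1.unique h2
    rw [hx, map_zero, innerSL_apply_apply, inner_smul_right] at h3
    rcases mul_eq_zero.1 h3.symm with h4 | h4
    · exact absurd (Complex.ofReal_eq_zero.1 h4) (hr n).ne'
    · exact inner_self_eq_zero.1 h4

/-- Partial isometries from `D` onto pairwise orthogonal subspaces of `K`. -/
structure IsFamily (M : VonNeumannAlgebra H) (D K : Submodule ℂ H) (S : Set (H →L[ℂ] H)) :
    Prop where
  isPartialIsom : ∀ s ∈ S, IsPartialIsom M s D K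
  orthogonal : ∀ s ∈ S, ∀ t ∈ S, s ≠ t → ∀ x ∈ D, ∀ y ∈ D, ⟪s x, t y⟫ = 0

/-- The part of `K` orthogonal to the ranges of a family. -/
noncomputable def rest (D K : Submodule ℂ H) (S : Set (H →L[ℂ] H)) : Submodule ℂ H :=
  K ⊓ (cspan {y | ∃ s ∈ S, ∃ x ∈ D, s x = y})ᗮ

lemma mem_rest {D K : Submodule ℂ H} {S : Set (H →L[ℂ] H)} {y : H} :
    y ∈ rest D K S ↔ y ∈ K ∧ ∀ s ∈ S, ∀ x ∈ D, ⟪s x, y⟫ = 0 := by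
  refine ⟨fun h => ⟨h.1, fun s hs x hx => h.2 _ (subset_cspan ⟨s, hs, x, hx, rfl⟩)⟩,
    fun h => ⟨h.1, fun u hu => inner_eq_zero_of_mem_cspan ?_ hu⟩⟩
  rintro _ ⟨s, hs, x, hx, rfl⟩
  exact h.2 s hs x hx

lemma IsFamily.isAffiliated_rest {D K : Submodule ℂ H} {S : Set (H →L[ℂ] H)}
    (hS : IsFamily M D K S) (hD : IsAffiliated M D) (hK : IsAffiliated M K) :
    IsAffiliated M (rest D K S) := by
  refine hK.inf (IsAffiliated.orthogonal (isAffiliated_cspan ?_))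
  rintro c hc _ ⟨s, hs, x, hx, rfl⟩
  exact ⟨s, hs, c x, hD.inv c hc x hx, (apply_comm (hS.isPartialIsom s hs).mem hc x).symm⟩

theorem IsFamily.exists_maximal {D K : Submodule ℂ H} {S₀ : Set (H →L[ℂ] H)}
    (hS₀ : IsFamily M D K S₀) (hD : IsAffiliated M D) (hK : IsAffiliated M K)
    (hne : ∃ d ∈ D, d ≠ 0) :
    ∃ S, S₀ ⊆ S ∧ IsFamily M D K S ∧ ∃ z, IsCentralProj M z ∧ (∃ d ∈ D, z d ≠ 0) ∧
      Emb M (cut z (rest D K S)) D := by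
  obtain ⟨S, hS₀S, hS⟩ := zorn_subset_nonempty {S | IsFamily M D K S} (by
    intro C hC hchain _
    refine ⟨⋃₀ C, ⟨?_, ?_⟩, fun s hs => Set.subset_sUnion_of_mem hs⟩
    · rintro s ⟨A, hA, hs⟩
      exact (hC hA).isPartialIsom s hs
    · rintro s ⟨A, hA, hs⟩ t ⟨A', hA', ht⟩
      rcases hchain.total hA hA' with h | h
      · exact (hC hA').orthogonal s (h hs) t ht
      · exact (hC hA).orthogonal s hs t (h ht)) S₀ hS₀
  have hfam : IsFamily M D K S := hS.prop
  refine ⟨S, hS₀S, hfam, ?_⟩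
  obtain ⟨z, hz, h1, h2⟩ := comparison hD (hfam.isAffiliated_rest hD hK)
  refine ⟨z, hz, ?_, h1⟩
  by_contra! hzero
  have h3 : Emb M D (rest D K S) := h2.mono (fun d hd => mem_cut.2 ⟨hd, by
    change d - z d = d
    rw [hzero d hd, sub_zero]⟩) le_rfl
  obtain ⟨t, ht⟩ := h3.exists_isPartialIsom hD
  have hins : IsFamily M D K (insert t S) := by
    refine ⟨?_, ?_⟩
    · rintro s (rfl | hs)
      · exact ⟨ht.mem, fun x => (ht.map_mem x).1, ht.star_map, ht.star_mem, ht.map_eq_zero⟩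
      · exact hfam.isPartialIsom s hs
    · rintro s (rfl | hs) s' (rfl | hs') hne x hx y hy
      · exact absurd rfl hne
      · rw [← inner_conj_symm, (mem_rest.1 (ht.map_mem x)).2 s' hs' y hy, map_zero]
      · exact (mem_rest.1 (ht.map_mem y)).2 s hs x hx
      · exact hfam.orthogonal s hs s' hs' hne x hx y hy
  have htS : t ∈ S := hS.le_of_ge hins (Set.subset_insert t S) (Set.mem_insert t S)
  obtain ⟨d, hd, hd0⟩ := hne
  have := (mem_rest.1 (ht.map_mem d)).2 t htS d hd
  rw [ht.inner_map hd, inner_self_eq_zero] at this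
  exact hd0 this

/-- Under `z`, the space `K` is generated by the ranges of a family and the rest. -/
lemma IsFamily.cut_le {D K U : Submodule ℂ H} {S : Set (H →L[ℂ] H)} {z : H →L[ℂ] H}
    (hS : IsFamily M D K S) (hz : IsCentralProj M z) (hU : IsAffiliated M U)
    (h₁ : ∀ s ∈ S, ∀ d ∈ D, z (s d) ∈ U) (h₂ : cut z (rest D K S) ≤ U) (hK : IsAffiliated M K) :
    cut z K ≤ U := by
  have hU' := hU.inf (hz.isAffiliated_cut hK)
  refine (hU'.mem_of_orthogonal (W := cut z K) inf_le_right fun r hr hr' => ?_).trans inf_le_left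
  have hzr := (mem_cut.1 hr).2
  have : r ∈ cut z (rest D K S) := mem_cut.2 ⟨mem_rest.2 ⟨hr.1, fun s hs d hd => by
    rw [← hzr, ← hz.inner_apply]
    exact hr' _ ⟨h₁ s hs d hd, hz.apply_mem hK ((hS.isPartialIsom s hs).map_mem d)⟩⟩, hzr⟩
  exact ⟨h₂ this, hr⟩

theorem IsFamily.emb_of_infinite {D K : Submodule ℂ H} {S : Set (H →L[ℂ] H)} {z : H →L[ℂ] H}
    (hS : IsFamily M D K S) (hD : IsAffiliated M D) (hK : IsAffiliated M K)
    (hz : IsCentralProj M z) (hg : Emb M (cut z (rest D K S)) D) (hinf : S.Infinite)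
    {B : H →L[ℂ] H} {Bn : ℕ → H →L[ℂ] H} (h : IsApprox M K B Bn) :
    Emb M (cut z (cspan (Set.range B))) K := by
  have hrest := hz.isAffiliated_cut (hS.isAffiliated_rest hD hK)
  obtain ⟨g, hg⟩ := hg.exists_isPartialIsom hrest
  have : Infinite S := hinf.to_subtype
  obtain ⟨σ⟩ : Nonempty ((ℕ × Option S) ↪ S) := by
    rw [← Cardinal.le_def, Cardinal.mk_prod, Cardinal.mk_option, Cardinal.mk_nat,
      Cardinal.lift_aleph0, Cardinal.lift_id']
    have h1 : Cardinal.aleph0 ≤ Cardinal.mk S := Cardinal.aleph0_le_mk S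
    rw [Cardinal.add_one_eq h1]
    exact (Cardinal.mul_eq_right h1 h1 Cardinal.aleph0_ne_zero).le
  have hσ : ∀ p, IsPartialIsom M (σ p).1 D K := fun p => hS.isPartialIsom _ (σ p).2
  have hσo : ∀ p q, p ≠ q → ∀ x ∈ D, ∀ y ∈ D, ⟪(σ p).1 x, (σ q).1 y⟫ = 0 := fun p q hpq =>
    hS.orthogonal _ (σ p).2 _ (σ q).2 fun h => hpq (σ.injective (Subtype.ext h))
  let W : Option S → Submodule ℂ H := fun i => i.casesOn (cut z (rest D K S)) fun _ => D
  let e : Option S → H →L[ℂ] H := fun i => i.casesOn 1 fun s => s.1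
  let k : Option S → H →L[ℂ] H := fun i => i.casesOn g fun _ => 1
  have hW : ∀ i, IsAffiliated M (W i) := by
    rintro (_ | s)
    · exact hrest
    · exact hD
  have he : ∀ i, e i ∈ M := by
    rintro (_ | s)
    · exact one_mem M
    · exact (hS.isPartialIsom s.1 s.2).mem
  have hk : ∀ i, k i ∈ M := by
    rintro (_ | s)
    · exact hg.mem
    · exact one_mem M
  have hkD : ∀ i, ∀ x ∈ W i, k i x ∈ D := by
    rintro (_ | s) x hx
    · exact hg.map_mem x
    · exact hx
  have hinner : ∀ n i j, ∀ x ∈ W i, ∀ y ∈ W j,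
      ⟪e i x, e j y⟫ = ⟪((σ (n, i)).1 * k i) x, ((σ (n, j)).1 * k j) y⟫ := by
    intro n i j x hx y hy
    change _ = ⟪(σ (n, i)).1 (k i x), (σ (n, j)).1 (k j y)⟫
    by_cases hij : i = j
    · subst hij
      rw [(hσ _).inner_map (hkD i x hx)]
      rcases i with _ | s
      · exact (hg.inner_map hx y).symm
      · exact (hS.isPartialIsom s.1 s.2).inner_map hx y
    · rw [hσo _ _ (fun h => hij (Prod.ext_iff.1 h).2) _ (hkD i x hx) _ (hkD j y hy)]
      rcases i with _ | s <;> rcases j with _ | t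
      · exact absurd rfl hij
      · change ⟪x, t.1 y⟫ = 0
        rw [← inner_conj_symm, (mem_rest.1 hx.1).2 t.1 t.2 y hy, map_zero]
      · exact (mem_rest.1 hy.1).2 s.1 s.2 x hx
      · exact hS.orthogonal _ s.2 _ t.2 (fun h => hij (by rw [Subtype.ext h])) x hx y hy
  have hglue := fun n => exists_glue hW he (fun i => mul_mem (hσ (n, i)).mem (hk i)) (hinner n)
  choose w hwM hwiso hwran using hglue
  choose R hRM hRK hR0 using h.exists_ker
  have hUK : cut z K ≤ cspan {y | ∃ i, ∃ x ∈ W i, e i x = y} := by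
    refine hS.cut_le hz ?_ (fun s hs d hd => ?_) (fun y hy => ?_) hK
    · refine isAffiliated_cspan ?_
      rintro c hc _ ⟨i, x, hx, rfl⟩
      exact ⟨i, c x, (hW i).inv c hc x hx, (apply_comm (he i) hc x).symm⟩
    · rw [hz.apply_comm (hS.isPartialIsom s hs).mem]
      exact subset_cspan ⟨some ⟨s, hs⟩, z d, hD.inv z hz.mem_commutant d hd, rfl⟩
    · exact subset_cspan ⟨none, y, hy, rfl⟩
  have hwK : ∀ n x, w n x ∈ K := fun n x => by
    refine cspan_le hK.closed ?_ (hwran n x)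
    rintro _ ⟨i, y, -, rfl⟩
    exact (hσ _).map_mem _
  obtain ⟨T, hTM, hTK, hT0⟩ := exists_sum_of_orthogonal hK.closed
    (fun n => mul_mem (hwM n) (hRM n)) (fun n x => hwK n _) (by
      intro m n hmn x y
      refine inner_eq_zero_of_mem_cspan ?_ (hwran m (R m x))
      rintro _ ⟨i, x', hx', rfl⟩
      rw [← inner_conj_symm]
      change starRingEnd ℂ ⟪w n (R n y), (σ (m, i)).1 (k i x')⟫ = 0
      rw [inner_eq_zero_of_mem_cspan ?_ (hwran n (R n y)), map_zero]
      rintro _ ⟨j, y', hy', rfl⟩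
      exact hσo _ _ (fun h => hmn (Prod.ext_iff.1 h).1.symm) _ (hkD j y' hy') _ (hkD i x' hx'))
  have hL : IsAffiliated M (cspan (Set.range B)) := isAffiliated_cspan (by
    rintro c hc _ ⟨x, rfl⟩
    exact ⟨c x, (apply_comm h.mem hc x).symm⟩)
  refine emb_of_injOn (hz.isAffiliated_cut hL) hK.closed hTM (fun x _ => hTK x)
    fun x hx hx0 => ?_
  have hstar : ∀ n, star (Bn n) x = 0 := fun n => by
    refine hR0 n x ?_
    have h1 : w n (R n x) = 0 := hT0 x hx0 n
    have h2 : R n x ∈ cut z K := mem_cut.2 ⟨hRK n x, by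
      rw [hz.apply_comm (hRM n), (mem_cut.1 hx).2]⟩
    rw [← norm_eq_zero, ← hwiso n _ (hUK h2), h1, norm_zero]
  have hBx : star B x = 0 := by
    refine tendsto_nhds_unique (h.tendsto x) ?_
    simp only [hstar]
    exact tendsto_const_nhds
  have : ⟪x, x⟫ = 0 := by
    refine inner_eq_zero_of_mem_cspan ?_ hx.1
    rintro _ ⟨y, rfl⟩
    rw [← star_inner_right, hBx, inner_zero_right]
  exact inner_self_eq_zero.1 this

lemma isAffiliated_cspan_range {B : H →L[ℂ] H} (hB : B ∈ M) :
    IsAffiliated M (cspan (Set.range B)) := isAffiliated_cspan (by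
  rintro c hc _ ⟨x, rfl⟩
  exact ⟨c x, (apply_comm hB hc x).symm⟩)

lemma mem_cspan_range {B : H →L[ℂ] H} {x : H} :
    x ∈ cspan (Set.range B) ↔ x ∈ closure (Set.range B) := by
  have : Submodule.span ℂ (Set.range B) = LinearMap.range (B : H →ₗ[ℂ] H) := by
    rw [← Submodule.span_eq (LinearMap.range (B : H →ₗ[ℂ] H)), LinearMap.coe_range]
    rfl
  rw [cspan, this]
  rfl

lemma eq_zero_of_mem_cspan_range {B z : H →L[ℂ] H} (h : ∀ x, z (B x) = 0) {x : H}
    (hx : x ∈ cspan (Set.range B)) : z x = 0 :=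
  cspan_le (W := LinearMap.ker (z : H →ₗ[ℂ] H)) z.isClosed_ker
    (by rintro _ ⟨y, rfl⟩; exact h y) hx

lemma exists_seq_of_countable {B : H →L[ℂ] H} {Y : Set H} (hY : Y.Countable)
    (hYB : ∀ y ∈ Y, y ∈ cspan (Set.range B)) :
    ∃ a : ℕ → H, ∀ V : Submodule ℂ H, IsClosed (V : Set H) → (∀ i, B (a i) ∈ V) →
      ∀ y ∈ Y, y ∈ V := by
  have hex : ∀ y : Y, ∃ u : ℕ → H, Tendsto (fun n => B (u n)) atTop (nhds y.1) := fun y => by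
    obtain ⟨s, hs, hlim⟩ := mem_closure_iff_seq_limit.1 (mem_cspan_range.1 (hYB y y.2))
    choose u hu using hs
    exact ⟨u, by simpa only [hu] using hlim⟩
  choose u hu using hex
  have := hY.to_subtype
  rcases isEmpty_or_nonempty Y with hemp | hne
  · exact ⟨0, fun V _ _ y hy => (hemp.false ⟨y, hy⟩).elim⟩
  obtain ⟨f, hf⟩ := exists_surjective_nat (Y × ℕ)
  refine ⟨fun i => u (f i).1 (f i).2, fun V hV h y hy => ?_⟩
  refine hV.mem_of_tendsto (hu ⟨y, hy⟩) (Eventually.of_forall fun n => ?_)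
  obtain ⟨i, hi⟩ := hf (⟨y, hy⟩, n)
  have := h i
  simp only [hi] at this
  exact this

/-- The closed subspace generated by `x` under the commutant. -/
noncomputable def cyclic (M : VonNeumannAlgebra H) (x : H) : Submodule ℂ H :=
  cspan {y | ∃ c ∈ M.commutant, c x = y}

lemma isAffiliated_cyclic (x : H) : IsAffiliated M (cyclic M x) := isAffiliated_cspan (by
  rintro c hc _ ⟨d, hd, rfl⟩
  exact ⟨c * d, mul_mem hc hd, rfl⟩)

lemma mem_cyclic (x : H) : x ∈ cyclic M x := subset_cspan ⟨1, one_mem _, rfl⟩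

lemma cyclic_le {x : H} {W : Submodule ℂ H} (hW : IsAffiliated M W) (hx : x ∈ W) :
    cyclic M x ≤ W := cspan_le hW.closed (by
  rintro _ ⟨c, hc, rfl⟩
  exact hW.inv c hc x hx)

lemma IsCentralProj.apply_ne_zero {z : H →L[ℂ] H} (hz : IsCentralProj M z) {x d : H}
    (hd : d ∈ cyclic M x) (hzd : z d ≠ 0) : z x ≠ 0 := fun h =>
  hzd (cyclic_le (isAffiliated_ker hz.mem) (W := LinearMap.ker (z : H →ₗ[ℂ] H)) h hd)

section Local

variable {K : Submodule ℂ H} {B : H →L[ℂ] H} {Bn : ℕ → H →L[ℂ] H}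

/-- If `K` is contained in the closed range of `B`, no central part of which embeds in `K`,
then families are finite. -/
lemma IsApprox.exists_finite_family (h : IsApprox M K B Bn) (hK : IsAffiliated M K)
    (hKB : K ≤ cspan (Set.range B))
    (hno : ∀ z, IsCentralProj M z → Emb M (cut z (cspan (Set.range B))) K → ∀ x, z (B x) = 0)
    {x : H} (hx : x ∈ K) (hx0 : x ≠ 0) {S₀ : Set (H →L[ℂ] H)}
    (hS₀ : IsFamily M (cyclic M x) K S₀) :
    ∃ S, S₀ ⊆ S ∧ S.Finite ∧ IsFamily M (cyclic M x) K S ∧ ∃ z, IsCentralProj M z ∧ z x ≠ 0 ∧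
      Emb M (cut z (rest (cyclic M x) K S)) (cyclic M x) := by
  obtain ⟨S, hSS, hS, z, hz, ⟨d, hd, hzd⟩, hemb⟩ :=
    hS₀.exists_maximal (isAffiliated_cyclic x) hK ⟨x, mem_cyclic x, hx0⟩
  have hzx := hz.apply_ne_zero hd hzd
  refine ⟨S, hSS, ?_, hS, z, hz, hzx, hemb⟩
  by_contra hinf
  exact hzx (eq_zero_of_mem_cspan_range
    (hno z hz (hS.emb_of_infinite (isAffiliated_cyclic x) hK hz hemb hinf h)) (hKB hx))

lemma IsApprox.isFin (h : IsApprox M K B Bn) (hK : IsAffiliated M K)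
    (hKB : K ≤ cspan (Set.range B))
    (hno : ∀ z, IsCentralProj M z → Emb M (cut z (cspan (Set.range B))) K →
      ∀ x, z (B x) = 0) : IsFin M K := by
  intro w₀ hw₀ hw₀' y hy hyw
  by_contra hy0
  obtain ⟨w, hw, hww⟩ := exists_isPartialIsom hK hw₀ hw₀'
  have hpow : ∀ n : ℕ, w ^ n ∈ M := fun n => pow_mem hw.mem n
  have hpowK : ∀ (n : ℕ), ∀ x ∈ K, (w ^ n) x ∈ K := fun n => by
    induction n with
    | zero => exact fun x hx => hx
    | succ n ih =>
      intro x hx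
      rw [pow_succ']
      exact hw.map_mem _
  have hinner : ∀ n : ℕ, ∀ x ∈ K, ∀ y, y ∈ K → ⟪(w ^ n) x, (w ^ n) y⟫ = ⟪x, y⟫ := fun n => by
    induction n with
    | zero => exact fun x _ y _ => rfl
    | succ n ih =>
      intro x hx y hy
      rw [pow_succ']
      exact (hw.inner_map (hpowK n x hx) _).trans (ih x hx y hy)
  have hDK : cyclic M y ≤ K := cyclic_le hK hy
  have hort : ∀ d ∈ cyclic M y, ∀ k ∈ K, ⟪d, w k⟫ = 0 := by
    intro d hd k hk
    refine inner_eq_zero_of_mem_cspan ?_ hd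
    rintro _ ⟨c, hc, rfl⟩
    have hc' := star_mem hc
    rw [← star_inner_right, apply_comm hw.mem hc', hww _ (hK.inv _ hc' k hk),
      ← inner_conj_symm, hyw _ (hK.inv _ hc' k hk), map_zero]
  have hlt : ∀ m n : ℕ, m < n → ∀ d ∈ cyclic M y, ∀ d' ∈ cyclic M y,
      ⟪(w ^ m) d, (w ^ n) d'⟫ = 0 := by
    intro m n hmn d hd d' hd'
    obtain ⟨k, rfl⟩ := Nat.exists_eq_add_of_lt hmn
    have : w ^ (m + k + 1) = w ^ m * (w * w ^ k) := by rw [← pow_succ', ← pow_add, add_assoc]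
    rw [this]
    change ⟪(w ^ m) d, (w ^ m) (w ((w ^ k) d'))⟫ = 0
    rw [hinner m d (hDK hd) _ (hw.map_mem _)]
    exact hort d hd _ (hpowK k d' (hDK hd'))
  have hs : ∀ n : ℕ, ∃ s, IsPartialIsom M s (cyclic M y) K ∧
      ∀ x ∈ cyclic M y, s x = (w ^ n) x := fun n =>
    exists_isPartialIsom (isAffiliated_cyclic y) (hpow n) fun x hx => ⟨by
      rw [@norm_eq_sqrt_re_inner ℂ, @norm_eq_sqrt_re_inner ℂ _ _ _ _ x,
        hinner n x (hDK hx) x (hDK hx)], hpowK n x (hDK hx)⟩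
  choose s hs hsw using hs
  have hso : ∀ m n : ℕ, m ≠ n → ∀ d ∈ cyclic M y, ∀ d' ∈ cyclic M y, ⟪s m d, s n d'⟫ = 0 := by
    intro m n hmn d hd d' hd'
    rw [hsw m d hd, hsw n d' hd']
    rcases lt_or_gt_of_ne hmn with h1 | h1
    · exact hlt m n h1 d hd d' hd'
    · rw [← inner_conj_symm, hlt n m h1 d' hd' d hd, map_zero]
  have hinj : Function.Injective s := by
    intro m n hmn
    by_contra hne
    have h1 := hso m n hne y (mem_cyclic y) y (mem_cyclic y)
    rw [hmn, (hs n).inner_map (mem_cyclic y), inner_self_eq_zero] at h1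
    exact hy0 h1
  obtain ⟨S, hSS, hSfin, -⟩ := h.exists_finite_family hK hKB hno hy hy0 (S₀ := Set.range s) ⟨by
    rintro _ ⟨n, rfl⟩
    exact hs n, by
    rintro _ ⟨m, rfl⟩ _ ⟨n, rfl⟩ hne
    exact hso m n fun h => hne (by rw [h])⟩
  exact (Set.infinite_range_of_injective hinj).mono hSS hSfin

lemma IsApprox.false_of_cyclic (h : IsApprox M K B Bn) (hK : IsAffiliated M K)
    (hKB : K ≤ cspan (Set.range B))
    (hno : ∀ z, IsCentralProj M z → Emb M (cut z (cspan (Set.range B))) K → ∀ x, z (B x) = 0)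
    {x : H} (hx : x ∈ K) (hx0 : x ≠ 0)
    (hemb : Emb M (cyclic M x) (cspan (Set.range B) ⊓ Kᗮ)) : False := by
  have hfin := h.isFin hK hKB hno
  obtain ⟨S, -, hSfin, hS, z, hz, hzx, hg⟩ := h.exists_finite_family hK hKB hno hx hx0
    (S₀ := ∅) ⟨fun s hs => hs.elim, fun s hs => hs.elim⟩
  have hD := isAffiliated_cyclic (M := M) x
  have hDK := cyclic_le hK hx
  obtain ⟨v, hv⟩ := hemb.exists_isPartialIsom hD
  obtain ⟨g, hg⟩ := hg.exists_isPartialIsom (hz.isAffiliated_cut (hS.isAffiliated_rest hD hK))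
  obtain ⟨a, ha⟩ := exists_seq_of_countable (B := B)
    (Y := insert (v (z x)) (insert (star g (z x)) ((fun s : H →L[ℂ] H => s (z x)) '' S)))
    (((hSfin.image _).insert _).insert _).countable (by
      rintro y (rfl | rfl | ⟨s, hs, rfl⟩)
      · exact (hv.map_mem _).1
      · exact hKB (hg.star_mem _).1.1
      · exact hKB ((hS.isPartialIsom s hs).map_mem _))
  obtain ⟨V, hV, hVK, hBa⟩ := h.exists_emb hK hfin a
  have hYV := ha V hV.closed hBa
  have hvV : v (z x) ∈ V := hYV _ (Or.inl rfl)
  have hgV : star g (z x) ∈ V := hYV _ (Or.inr (Or.inl rfl))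
  have hsV : ∀ s ∈ S, s (z x) ∈ V := fun s hs => hYV _ (Or.inr (Or.inr ⟨s, hs, rfl⟩))
  have hKV : cut z K ≤ V := by
    refine hS.cut_le hz hV (fun s hs d hd => ?_) ?_ hK
    · have hsM := (hS.isPartialIsom s hs).mem
      refine map_mem_of_mem_cspan hV.closed (z * s) ?_ hd
      rintro _ ⟨c, hc, rfl⟩
      change z (s (c x)) ∈ V
      rw [hz.apply_comm hsM, ← apply_comm hz.mem hc, ← apply_comm hsM hc]
      exact hV.inv c hc _ (hsV s hs)
    · have hR := hz.isAffiliated_cut (hS.isAffiliated_rest hD hK)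
      refine ((hV.inf hR).mem_of_orthogonal (W := cut z (rest (cyclic M x) K S)) inf_le_right
        fun r hr hr' => ?_).trans inf_le_left
      have h1 : g r = 0 := by
        rw [← inner_self_eq_zero (𝕜 := ℂ)]
        refine inner_eq_zero_of_mem_cspan ?_ (hg.map_mem r)
        rintro _ ⟨c, hc, rfl⟩
        rw [← star_inner_left, ← apply_comm (star_mem hg.mem) hc]
        have h2 : ⟪c (star g x), r⟫ = ⟪c (star g (z x)), r⟫ := by
          nth_rw 1 [← (mem_cut.1 hr).2]
          rw [← hz.inner_apply, ← apply_comm hz.mem hc, hz.apply_comm (star_mem hg.mem)]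
        rw [h2]
        exact hr' _ ⟨hV.inv c hc _ hgV, hR.inv c hc _ (hg.star_mem _)⟩
      have h2 : r = 0 := by rw [← norm_eq_zero, ← hg.norm_map hr, h1, norm_zero]
      rw [h2]
      exact Submodule.zero_mem _
  obtain ⟨f, hf⟩ := hVK.exists_isPartialIsom hV
  have hy := hfin (f * z + (1 - z)) (add_mem (mul_mem hf.mem hz.mem) hz.compl.mem)
    (fun k hk => by
      change ‖f (z k) + (k - z k)‖ = _ ∧ f (z k) + (k - z k) ∈ K
      refine ⟨?_, K.add_mem (hf.map_mem _) (K.sub_mem hk (hK.inv z hz.mem_commutant k hk))⟩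
      have := norm_add_eq_norm_add (hz.inner_compl k k)
        (a' := f (z k)) (b' := k - z k) (by
          have h3 : f (z k) = z (f (z k)) := by rw [hz.apply_comm hf.mem, hz.apply_apply]
          rw [h3, hz.inner_compl])
        (hf.norm_map (hKV (hz.apply_mem hK hk))) rfl
      rwa [add_sub_cancel] at this)
    (f (v (z x))) (hf.map_mem _) (fun k hk => by
      change ⟪f (z k) + (k - z k), f (v (z x))⟫ = 0
      have hzk := hz.apply_mem hK hk
      rw [inner_add_left, hf.inner_map (hKV hzk), (hv.map_mem _).2 _ hzk.1, zero_add,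
        ← hz.apply_comm hv.mem, ← hz.apply_comm hf.mem, ← hz.inner_apply, map_sub,
        hz.apply_apply, sub_self, inner_zero_left])
  refine hzx ?_
  rw [← norm_eq_zero, ← hv.norm_map (hD.inv z hz.mem_commutant x (mem_cyclic x)),
    ← hf.norm_map hvV, hy, norm_zero]

lemma IsPartialIsom.isAffiliated_range {v : H →L[ℂ] H} {W V : Submodule ℂ H}
    (hv : IsPartialIsom M v W V) :
    IsAffiliated M (LinearMap.ker ((1 - v * star v : H →L[ℂ] H) : H →ₗ[ℂ] H)) :=
  isAffiliated_ker (sub_mem (one_mem _) (mul_mem hv.mem (StarMemClass.star_mem hv.mem)))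

lemma mem_ker_one_sub {v : H →L[ℂ] H} {y : H} :
    y ∈ LinearMap.ker ((1 - v * star v : H →L[ℂ] H) : H →ₗ[ℂ] H) ↔ v (star v y) = y := by
  change y - v (star v y) = 0 ↔ _
  rw [sub_eq_zero, eq_comm]

lemma IsPartialIsom.emb_range {v : H →L[ℂ] H} {W V : Submodule ℂ H}
    (hv : IsPartialIsom M v W V) :
    Emb M (LinearMap.ker ((1 - v * star v : H →L[ℂ] H) : H →ₗ[ℂ] H)) W :=
  ⟨star v, StarMemClass.star_mem hv.mem, fun y hy => ⟨by
    rw [hv.norm_star, mem_ker_one_sub.1 hy], hv.star_mem y⟩⟩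

lemma IsApprox.false_of_le (h : IsApprox M K B Bn) (hK : IsAffiliated M K)
    (hKB : K ≤ cspan (Set.range B))
    (hno : ∀ z, IsCentralProj M z → Emb M (cut z (cspan (Set.range B))) K → ∀ x, z (B x) = 0)
    (hB : B ≠ 0) : False := by
  have hL := isAffiliated_cspan_range h.mem
  have hF := hL.inf hK.orthogonal
  obtain ⟨z, hz, h1, h2⟩ := comparison hF hK
  by_cases hzK : ∃ x ∈ cut z K, x ≠ 0
  · obtain ⟨x, hx, hx0⟩ := hzK
    exact h.false_of_cyclic hK hKB hno hx.1 hx0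
      (h1.mono (cyclic_le (hz.isAffiliated_cut hK) hx) le_rfl)
  by_cases hzF : ∃ y ∈ cut (1 - z) (cspan (Set.range B) ⊓ Kᗮ), y ≠ 0
  · obtain ⟨y, hy, hy0⟩ := hzF
    obtain ⟨u, hu⟩ := h2.exists_isPartialIsom (hz.compl.isAffiliated_cut hF)
    refine h.false_of_cyclic hK hKB hno (hu.map_mem y) (fun h0 => hy0 ?_)
      (hu.emb_range.mono (cyclic_le hu.isAffiliated_range ?_) (VonNeumannAlgebra.cut_le _ _))
    · rw [← norm_eq_zero, ← hu.norm_map hy, h0, norm_zero]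
    · rw [mem_ker_one_sub, hu.star_map y hy]
  push Not at hzK hzF
  have hz1 : ∀ x, (1 - z) (B x) = 0 := by
    refine hno _ hz.compl (Emb.of_le fun l hl => ?_)
    obtain ⟨p, hpM, hps, hpW, hpf, hpo, hp0⟩ := hK.exists_proj
    have h3 : l - p l ∈ cspan (Set.range B) ⊓ Kᗮ :=
      ⟨Submodule.sub_mem _ hl.1 (hKB (hpW l)), hpo l⟩
    have h4 := hzF _ (hz.compl.apply_mem hF h3)
    rw [map_sub, (mem_cut.1 hl).2, sub_eq_zero] at h4
    rw [h4]
    exact hK.inv _ hz.compl.mem_commutant _ (hpW l)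
  have hzBn : ∀ n x, Bn n (z x) = 0 := fun n x => by
    obtain ⟨v, hv, hv'⟩ := h.emb n
    have h5 : v (Bn n (z x)) = 0 := by
      rw [← hz.apply_comm (h.mem_seq n), ← hz.apply_comm hv]
      exact hzK _ (hz.apply_mem hK (hv' x).2)
    rw [← norm_eq_zero, ← (hv' _).1, h5, norm_zero]
  have hzstar : ∀ x, star B (z x) = 0 := fun x => by
    refine tendsto_nhds_unique (h.tendsto (z x)) ?_
    have : ∀ n, star (Bn n) (z x) = 0 := fun n => by
      rw [← inner_self_eq_zero (𝕜 := ℂ), star_inner_left, hz.inner_apply,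
        hz.apply_comm (h.mem_seq n), hzBn, inner_zero_right]
    simp only [this]
    exact tendsto_const_nhds
  refine hB ?_
  ext x
  have h6 : B x = z (B x) := sub_eq_zero.1 (hz1 x)
  change B x = 0
  rw [← inner_self_eq_zero (𝕜 := ℂ)]
  nth_rw 1 [h6]
  rw [← star_inner_left, hzstar, inner_zero_left]

lemma IsApprox.cut {z : H →L[ℂ] H} (h : IsApprox M K B Bn) (hK : IsAffiliated M K)
    (hz : IsCentralProj M z) :
    IsApprox M (cut z K) (z * B) (fun n => z * Bn n) := by
  refine ⟨mul_mem hz.mem h.mem, fun n => mul_mem hz.mem (h.mem_seq n), fun n => ?_, fun x => ?_⟩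
  · obtain ⟨v, hv, hv'⟩ := h.emb n
    refine ⟨v, hv, fun x => ?_⟩
    change ‖v (z (Bn n x))‖ = ‖z (Bn n x)‖ ∧ v (z (Bn n x)) ∈ _
    constructor
    · rw [hz.apply_comm (h.mem_seq n)]
      exact (hv' _).1
    · rw [← hz.apply_comm hv]
      exact hz.apply_mem hK (hv' x).2
  · simp only [star_mul, hz.star_eq]
    exact h.tendsto (z x)

lemma IsApprox.trans {K' : Submodule ℂ H} (h : IsApprox M K B Bn) (hKK : Emb M K K') :
    IsApprox M K' B Bn := by
  obtain ⟨w, hw, hw'⟩ := hKK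
  refine ⟨h.mem, h.mem_seq, fun n => ?_, h.tendsto⟩
  obtain ⟨v, hv, hv'⟩ := h.emb n
  exact ⟨w * v, mul_mem hw hv, fun x =>
    ⟨(hw' _ (hv' x).2).1.trans (hv' x).1, (hw' _ (hv' x).2).2⟩⟩

/-- Some nonzero central part of the range of `B` embeds in `K`. -/
theorem IsApprox.exists_cut (h : IsApprox M K B Bn) (hK : IsAffiliated M K) (hB : B ≠ 0) :
    ∃ z, IsCentralProj M z ∧ (∃ x, z (B x) ≠ 0) ∧ Emb M (VonNeumannAlgebra.cut z
      (cspan (Set.range B))) K := by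
  by_contra! hcon
  have hno : ∀ z, IsCentralProj M z → Emb M (VonNeumannAlgebra.cut z (cspan (Set.range B))) K →
      ∀ x, z (B x) = 0 := by
    intro z hz hemb
    by_contra! hx
    exact hcon z hz hx hemb
  obtain ⟨z, hz, h1, h2⟩ := comparison hK (isAffiliated_cspan_range h.mem)
  have hzB : (1 - z) * B = B := by
    ext x
    change B x - z (B x) = B x
    rw [hno z hz h1, sub_zero]
  obtain ⟨v, hv⟩ := h2.exists_isPartialIsom (hz.compl.isAffiliated_cut hK)
  have h3 := (h.cut hK hz.compl).trans (K' := LinearMap.ker ((1 - v * star v : H →L[ℂ] H) :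
    H →ₗ[ℂ] H)) ⟨v, hv.mem, fun x hx => ⟨hv.norm_map hx, by
      rw [mem_ker_one_sub, hv.star_map x hx]⟩⟩
  rw [hzB] at h3
  refine h3.false_of_le hv.isAffiliated_range (fun y hy => ?_) (fun e he hemb => ?_) hB
  · rw [← mem_ker_one_sub.1 hy]
    exact hv.map_mem _
  · exact hno e he (hemb.trans (hv.emb_range.mono le_rfl (VonNeumannAlgebra.cut_le _ _)))

/-- The range of `B` embeds in `K`. -/
theorem IsApprox.emb_range (h : IsApprox M K B Bn) (hK : IsAffiliated M K) :
    Emb M (cspan (Set.range B)) K := by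
  obtain ⟨C, hC⟩ := zorn_subset {C : Set (H →L[ℂ] H) |
      (∀ z ∈ C, IsCentralProj M z ∧ Emb M (VonNeumannAlgebra.cut z (cspan (Set.range B))) K) ∧
      ∀ z ∈ C, ∀ z' ∈ C, z ≠ z' → ∀ x, z (z' x) = 0} (by
    intro C hC hchain
    refine ⟨⋃₀ C, ⟨?_, ?_⟩, fun s hs => Set.subset_sUnion_of_mem hs⟩
    · rintro z ⟨A, hA, hz⟩
      exact (hC hA).1 z hz
    · rintro z ⟨A, hA, hz⟩ z' ⟨A', hA', hz'⟩
      rcases hchain.total hA hA' with h | h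
      · exact (hC hA').2 z (h hz) z' hz'
      · exact (hC hA).2 z hz z' (h hz'))
  obtain ⟨hCz, hCo⟩ := hC.prop
  have hL := isAffiliated_cspan_range h.mem
  have hcut : ∀ z : C, IsAffiliated M (VonNeumannAlgebra.cut z.1 (cspan (Set.range B))) :=
    fun z => (hCz z z.2).1.isAffiliated_cut hL
  have hex := fun z : C => (hCz z z.2).2.exists_isPartialIsom (hcut z)
  choose f hf using hex
  obtain ⟨v, hvM, hviso, hvran⟩ := exists_glue (e := fun _ : C => 1) hcut (fun _ => one_mem M)
    (fun z => (hf z).mem) (by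
      intro z z' x hx y hy
      change ⟪x, y⟫ = _
      by_cases hzz : z = z'
      · subst hzz
        exact ((hf z).inner_map hx y).symm
      · have h0 := hCo z z.2 z' z'.2 fun h => hzz (Subtype.ext h)
        have hz := (hCz z z.2).1
        have hz' := (hCz z' z'.2).1
        rw [← (mem_cut.1 hx).2, ← (mem_cut.1 hy).2, hz.inner_apply, h0, inner_zero_right,
          ← hz.apply_comm (hf z).mem, ← hz'.apply_comm (hf z').mem, hz.inner_apply, h0,
          inner_zero_right])
  refine ⟨v, hvM, fun x hx => ⟨hviso x ?_, ?_⟩⟩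
  · have hU : IsAffiliated M (cspan {y | ∃ z : C, ∃ x ∈ VonNeumannAlgebra.cut z.1
        (cspan (Set.range B)), (1 : H →L[ℂ] H) x = y}) := isAffiliated_cspan (by
      rintro c hc _ ⟨z, x, hx, rfl⟩
      exact ⟨z, c x, (hcut z).inv c hc x hx, rfl⟩)
    refine hU.mem_of_orthogonal (W := cspan (Set.range B)) (cspan_le hL.closed ?_)
      (fun r hr hr' => ?_) hx
    · rintro _ ⟨z, x, hx, rfl⟩
      exact hx.1
    have hzr : ∀ z ∈ C, z r = 0 := fun z hz => by
      have h1 := hr' _ (subset_cspan ⟨⟨z, hz⟩, z r, (hCz z hz).1.apply_mem hL hr, rfl⟩)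
      change ⟪z r, r⟫ = 0 at h1
      rwa [← (hCz z hz).1.apply_apply, (hCz z hz).1.inner_apply, inner_self_eq_zero] at h1
    let Z : Submodule ℂ H := ⨅ z ∈ C, LinearMap.ker (z : H →ₗ[ℂ] H)
    have hZmem : ∀ x, x ∈ Z ↔ ∀ z ∈ C, z x = 0 := fun x => by
      simp [Z, Submodule.mem_iInf]
    have hZ : IsAffiliated M Z := by
      refine ⟨?_, fun c hc x hx => ?_⟩
      · simp only [Z, Submodule.coe_iInf]
        exact isClosed_biInter fun z _ => z.isClosed_ker
      · rw [hZmem] at hx ⊢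
        intro z hz
        rw [← apply_comm (hCz z hz).1.mem hc, hx z hz, map_zero]
    obtain ⟨e, he, heZ, hef, -⟩ := exists_isCentralProj hZ (fun T hT x hx => by
      rw [hZmem] at hx ⊢
      intro z hz
      rw [(hCz z hz).1.apply_comm hT, hx z hz, map_zero])
    by_contra hrU
    have her : e r = r := hef r ((hZmem r).2 hzr)
    have heB : e * B ≠ 0 := fun h0 => by
      refine hrU ?_
      rw [← her, eq_zero_of_mem_cspan_range (DFunLike.congr_fun h0) hr]
      exact Submodule.zero_mem _
    obtain ⟨z', hz', ⟨y, hy⟩, hemb⟩ := ((h.cut hK he).trans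
      (Emb.of_le (VonNeumannAlgebra.cut_le e K))).exists_cut hK heB
    have hze : ∀ z ∈ C, ∀ x, z (e x) = 0 := fun z hz x => (hZmem _).1 (heZ x) z hz
    have hze' : ∀ z ∈ C, ∀ x, e (z x) = 0 := fun z hz x => by
      rw [← (hCz z hz).1.apply_comm he.mem, hze z hz]
    have hins : insert (z' * e) C ∈ {C : Set (H →L[ℂ] H) |
        (∀ z ∈ C, IsCentralProj M z ∧
          Emb M (VonNeumannAlgebra.cut z (cspan (Set.range B))) K) ∧
        ∀ z ∈ C, ∀ z' ∈ C, z ≠ z' → ∀ x, z (z' x) = 0} := by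
      refine ⟨?_, ?_⟩
      · rintro z (rfl | hz)
        · refine ⟨hz'.mul he, hemb.mono (fun x hx => ?_) le_rfl⟩
          have hx2 : z' (e x) = x := (mem_cut.1 hx).2
          have hex : e x = x := by
            rw [← hx2, ← hz'.apply_comm he.mem, he.apply_apply]
          refine mem_cut.2 ⟨?_, by rw [← hx2, hz'.apply_apply]⟩
          rw [← hex]
          refine map_mem_of_mem_cspan (isClosed_cspan _) e ?_ hx.1
          rintro _ ⟨x, rfl⟩
          exact subset_cspan ⟨x, rfl⟩
        · exact hCz z hz
      · rintro z (rfl | hz) w (rfl | hw) hne x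
        · exact absurd rfl hne
        · change z' (e (w x)) = 0
          rw [hze' w hw, map_zero]
        · change z (z' (e x)) = 0
          rw [hz'.apply_comm he.mem, hze z hz]
        · exact hCo z hz w hw hne x
    have hmem := hC.le_of_ge hins (Set.subset_insert _ _) (Set.mem_insert _ _)
    have h0 := hze _ hmem (B y)
    change z' (e (e (B y))) = 0 at h0
    rw [he.apply_apply] at h0
    exact hy h0
  · refine cspan_le hK.closed ?_ (hvran x)
    rintro _ ⟨z, x, -, rfl⟩
    exact (hf z).map_mem x

end Local


end VonNeumannAlgebra

lemma IsRangeProjection.apply_of_mem {r T : H →L[ℂ] H} (h : IsRangeProjection r T) {x : H}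
    (hx : x ∈ closure (Set.range T)) : r x = x := by
  rw [← h.2.2] at hx
  obtain ⟨y, rfl⟩ := hx
  exact DFunLike.congr_fun h.1 y

theorem stmt13 (M : VonNeumannAlgebra H) (A B : H →L[ℂ] H) (Bn : ℕ → (H →L[ℂ] H))
    (hA : A ∈ M) (hB : B ∈ M) (hBn : ∀ n, Bn n ∈ M)
    (hrank : ∀ n, ∃ v rBn rA : H →L[ℂ] H, v ∈ M ∧
      IsRangeProjection rBn (Bn n) ∧ IsRangeProjection rA A ∧
      star v * v = rBn ∧ rA * (v * star v) = v * star v)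
    (hconv : ∀ x : H, Tendsto (fun n => Bn n x) atTop (nhds (B x)) ∧
      Tendsto (fun n => star (Bn n) x) atTop (nhds (star B x))) :
    ∃ w rB rA : H →L[ℂ] H, w ∈ M ∧
      IsRangeProjection rB B ∧ IsRangeProjection rA A ∧
      star w * w = rB ∧ rA * (w * star w) = w * star w := by
  have hK := VonNeumannAlgebra.isAffiliated_cspan_range hA
  have hL := VonNeumannAlgebra.isAffiliated_cspan_range hB
  have happrox : VonNeumannAlgebra.IsApprox M (VonNeumannAlgebra.cspan (Set.range A)) B Bn := by
    refine ⟨hB, hBn, fun n => ?_, fun x => (hconv x).2⟩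
    obtain ⟨v, rBn, rA, hv, hrBn, hrA, hvv, hle⟩ := hrank n
    refine ⟨v, hv, fun x => ?_⟩
    have h1 : star v (v (Bn n x)) = Bn n x :=
      (DFunLike.congr_fun hvv (Bn n x)).trans
        (hrBn.apply_of_mem (subset_closure (Set.mem_range_self x)))
    constructor
    · rw [@norm_eq_sqrt_re_inner ℂ, @norm_eq_sqrt_re_inner ℂ _ _ _ _ (Bn n x),
        ← VonNeumannAlgebra.star_inner_left, h1]
    · rw [VonNeumannAlgebra.mem_cspan_range, ← hrA.2.2]
      have h2 : rA (v (star v (v (Bn n x)))) = v (star v (v (Bn n x))) :=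
        DFunLike.congr_fun hle (v (Bn n x))
      rw [h1] at h2
      exact ⟨_, h2⟩
  obtain ⟨w, hw⟩ := (happrox.emb_range hK).exists_isPartialIsom hL
  obtain ⟨p, -, hps, hpL, hpf, hpo, -⟩ := hL.exists_proj
  obtain ⟨-, -, rA, -, -, hrA, -, -⟩ := hrank 0
  refine ⟨w, p, rA, hw.mem, ⟨?_, hps, ?_⟩, hrA, ?_, ?_⟩
  · ext x
    exact hpf _ (hpL x)
  · ext x
    rw [← VonNeumannAlgebra.mem_cspan_range]
    exact ⟨by rintro ⟨y, rfl⟩; exact hpL y, fun hx => ⟨x, hpf x hx⟩⟩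
  · ext x
    have h1 : w x = w (p x) := by
      rw [← sub_eq_zero, ← map_sub]
      exact hw.map_eq_zero _ fun y hy => hpo x y hy
    change star w (w x) = p x
    rw [h1, hw.star_map _ (hpL x)]
  · ext x
    exact hrA.apply_of_mem (VonNeumannAlgebra.mem_cspan_range.1 (hw.map_mem _))
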